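/- arXiv:math/0703840 — 3 statements merged into one kernel-verified Lean document; each statement's English description precedes it below -/
import Mathlib

section
/- In a fine grading of a finite-dimensional simple Lie algebra over an algebraically closed field of characteristic zero, every homogeneous element is either ad-semisimple or ad-nilpotent. Precisely: if L is a finite-dimensional simple Lie algebra over F, G is an abelian group, and L = ⊕_{g∈G} L_g is a fine G-grading, then for every g ∈ G and every x ∈ L_g, the endomorphism ad x of L is semisimple or nilpotent. -/
open Polynomial in
theorem fg_exists_poly (F : Type*) [Field F] [IsAlgClosed F] [CharZero F]
    (m : ℕ) (hm : m ≠ 0) (Λ : Finset F) (N : ℕ) :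
    ∃ q : F[X], (∀ a ∈ Λ, (X - C a) ^ N ∣ q - C a) ∧
      ∀ k, q.coeff k ≠ 0 → k ≡ 1 [MOD m] := by
  classical
  have : NeZero (m : F) := ⟨by exact_mod_cast hm⟩
  have : NeZero m := ⟨hm⟩
  obtain ⟨ζ, hζ⟩ := HasEnoughRootsOfUnity.exists_primitiveRoot F m
  have hζ0 : ζ ≠ 0 := hζ.ne_zero hm
  have crt : ∃ p : F[X], ∀ a : F, a ∈ (Finset.range m).biUnion (fun j => Λ.image (fun a => ζ ^ j * a)) →
      (X - C a) ^ N ∣ p - C a := by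
    set T := (Finset.range m).biUnion (fun j => Λ.image (fun a => ζ ^ j * a))
    obtain ⟨p, hp⟩ := Ideal.exists_forall_sub_mem_ideal (R := F[X]) (ι := T)
      (I := fun a => Ideal.span {(X - C (a : F)) ^ N}) (by
        intro a b hab
        simp only [Function.onFun]
        rw [Ideal.isCoprime_span_singleton_iff]
        exact (isCoprime_X_sub_C_of_isUnit_sub
          (sub_ne_zero.mpr (fun h => hab (Subtype.ext h))).isUnit).pow) (fun a => C (a : F))
    exact ⟨p, fun a ha => Ideal.mem_span_singleton.mp (hp ⟨a, ha⟩)⟩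
  obtain ⟨p, hp⟩ := crt
  refine ⟨C (m : F)⁻¹ * ∑ j ∈ Finset.range m, C ((ζ ^ j)⁻¹) * p.comp (C (ζ ^ j) * X), ?_, ?_⟩
  · intro a ha
    have key : C (m : F)⁻¹ * ∑ j ∈ Finset.range m, C ((ζ ^ j)⁻¹) * p.comp (C (ζ ^ j) * X) - C a
        = C (m : F)⁻¹ * ∑ j ∈ Finset.range m,
          C ((ζ ^ j)⁻¹) * (p.comp (C (ζ ^ j) * X) - C (ζ ^ j * a)) := by
      simp_rw [mul_sub, Finset.sum_sub_distrib, mul_sub]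
      congr 1
      have : ∀ j ∈ Finset.range m, C ((ζ ^ j)⁻¹) * C (ζ ^ j * a) = C a := by
        intro j _
        rw [← C_mul, inv_mul_cancel_left₀ (pow_ne_zero _ hζ0)]
      rw [Finset.sum_congr rfl this, Finset.sum_const, Finset.card_range, nsmul_eq_mul,
        ← C_eq_natCast, ← C_mul, ← C_mul, inv_mul_cancel_left₀ (NeZero.ne (m : F))]
    rw [key]
    refine Dvd.dvd.mul_left (Finset.dvd_sum fun j hj => Dvd.dvd.mul_left ?_ _) _
    obtain ⟨r, hr⟩ := hp (ζ ^ j * a) (Finset.mem_biUnion.mpr ⟨j, hj, Finset.mem_image_of_mem _ ha⟩)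
    have h2 : p.comp (C (ζ ^ j) * X) - C (ζ ^ j * a)
        = (C (ζ ^ j)) ^ N * (X - C a) ^ N * r.comp (C (ζ ^ j) * X) := by
      have := congrArg (fun t => t.comp (C (ζ ^ j) * X)) hr
      simp only [sub_comp, C_comp, mul_comp, pow_comp, X_comp] at this
      rw [this, ← mul_pow]
      congr 2
      rw [mul_sub, C_mul]
    rw [h2]
    exact ⟨(C (ζ ^ j)) ^ N * r.comp (C (ζ ^ j) * X), by ring⟩
  · intro k hk
    by_contra hne
    apply hk
    rw [coeff_C_mul, finsetSum_coeff]
    simp_rw [coeff_C_mul, comp_C_mul_X_coeff]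
    set w := ζ ^ k * ζ⁻¹ with hw
    have hw1 : w ≠ 1 := by
      intro h
      apply hne
      have : ζ ^ k = ζ ^ 1 := by
        rw [pow_one]; exact (mul_inv_eq_one₀ hζ0).mp h
      rw [hζ.eq_orderOf]
      have h2 : (Units.mk0 ζ hζ0) ^ k = (Units.mk0 ζ hζ0) ^ 1 := by
        ext; simpa using this
      have h3 : orderOf ζ = orderOf (Units.mk0 ζ hζ0) := by
        rw [← orderOf_units]; rfl
      rw [h3]
      exact pow_eq_pow_iff_modEq.mp h2
    have hwm : w ^ m = 1 := by
      rw [hw, mul_pow, inv_pow, ← pow_mul, mul_comm k, pow_mul, hζ.pow_eq_one]; simp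
    have hs : ∑ j ∈ Finset.range m, w ^ j = 0 := by
      have := mul_geom_sum w m
      rw [hwm, sub_self] at this
      exact (mul_eq_zero.mp this).resolve_left (sub_ne_zero.mpr hw1)
    have : ∀ j ∈ Finset.range m, (ζ ^ j)⁻¹ * (p.coeff k * (ζ ^ j) ^ k) = p.coeff k * w ^ j := by
      intro j _
      rw [hw, mul_pow, inv_pow, ← pow_mul, ← pow_mul, mul_comm k]; ring
    rw [Finset.sum_congr rfl this, ← Finset.mul_sum, hs]; simp

open Polynomial in
theorem fg_jordan (F : Type*) [Field F] [IsAlgClosed F] [CharZero F]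
    (V : Type*) [AddCommGroup V] [Module F V] [FiniteDimensional F V] (f : Module.End F V)
    (m : ℕ) (hm : m ≠ 0) :
    ∃ q : F[X], (∀ k, q.coeff k ≠ 0 → k ≡ 1 [MOD m]) ∧
      (∀ a : F, ∀ v ∈ f.maxGenEigenspace a, aeval f q v = a • v) ∧
      (aeval f q).IsSemisimple ∧ IsNilpotent (f - aeval f q) := by
  classical
  set N := Module.finrank F V + 1 with hN
  have hfin : Set.Finite {a | f.HasEigenvalue a} := f.finite_hasEigenvalue
  obtain ⟨q, hq, hqm⟩ := fg_exists_poly F m hm hfin.toFinset N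
  have hev : ∀ a : F, ∀ v ∈ f.maxGenEigenspace a, v ≠ 0 → a ∈ hfin.toFinset := by
    intro a v hv hv0
    simp only [Set.Finite.mem_toFinset, Set.mem_ofPred_eq]
    rw [Module.End.maxGenEigenspace_eq_genEigenspace_finrank] at hv
    refine Module.End.hasEigenvalue_of_hasGenEigenvalue (k := Module.finrank F V) ?_
    intro h
    rw [h] at hv
    exact hv0 (by simpa using hv)
  have hpow : ∀ a : F, ∀ v ∈ f.maxGenEigenspace a, aeval f ((X - C a) ^ N) v = 0 := by
    intro a v hv
    rw [Module.End.maxGenEigenspace_eq_genEigenspace_finrank,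
      Module.End.mem_genEigenspace_nat, LinearMap.mem_ker] at hv
    rw [map_pow, map_sub, aeval_X, aeval_C, hN, pow_succ']
    rw [Module.End.mul_apply, Algebra.algebraMap_eq_smul_one, hv, map_zero]
  have hdvd : ∀ a : F, ∀ v ∈ f.maxGenEigenspace a, ∀ r : F[X], (X - C a) ^ N ∣ r →
      aeval f r v = 0 := by
    rintro a v hv r ⟨t, rfl⟩
    rw [mul_comm, map_mul, Module.End.mul_apply, hpow a v hv, map_zero]
  have hS : ∀ a : F, ∀ v ∈ f.maxGenEigenspace a, aeval f q v = a • v := by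
    intro a v hv
    by_cases hv0 : v = 0
    · simp [hv0]
    have := hdvd a v hv _ (hq a (hev a v hv hv0))
    rw [map_sub, aeval_C, LinearMap.sub_apply, sub_eq_zero] at this
    rw [this]; simp [Algebra.algebraMap_eq_smul_one]
  have htop : ∀ g : Module.End F V, (∀ a : F, ∀ v ∈ f.maxGenEigenspace a, g v = 0) → g = 0 := by
    intro g hg
    rw [← LinearMap.ker_eq_top, eq_top_iff, ← f.iSup_maxGenEigenspace_eq_top]
    exact iSup_le fun a v hv => hg a v hv
  refine ⟨q, hqm, hS, ?_, ?_⟩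
  · refine Module.End.isSemisimple_of_squarefree_aeval_eq_zero
      (p := ∏ a ∈ hfin.toFinset, (X - C a)) ?_ ?_
    · exact (separable_prod_X_sub_C_iff' (f := fun a : F => a)).mpr (fun _ _ _ _ h => h) |>.squarefree
    · apply htop
      intro a v hv
      by_cases hv0 : v = 0
      · simp [hv0]
      rw [← Finset.prod_erase_mul _ _ (hev a v hv hv0), map_mul, Module.End.mul_apply]
      rw [map_sub, aeval_X, aeval_C, LinearMap.sub_apply, hS a v hv]
      simp [Algebra.algebraMap_eq_smul_one]
  · refine ⟨N, ?_⟩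
    apply htop
    intro a v hv
    by_cases hv0 : v = 0
    · simp [hv0]
    have h1 : f - aeval f q = aeval f (X - q) := by simp
    rw [h1, ← map_pow]
    refine hdvd a v hv _ (pow_dvd_pow_of_dvd ?_ N)
    have h2 : X - q = (X - C a) - (q - C a) := by ring
    rw [h2]
    exact dvd_sub dvd_rfl ((dvd_pow_self _ (by omega)).trans (hq a (hev a v hv hv0)))

theorem fg_exists_h (F : Type*) [Field F] [IsAlgClosed F] [CharZero F]
    (L : Type*) [LieRing L] [LieAlgebra F L] [FiniteDimensional F L]
    [LieAlgebra.IsKilling F L] (s n : L)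
    (hs : (LieAlgebra.ad F L s).IsSemisimple) (hn : IsNilpotent (LieAlgebra.ad F L n))
    (hsn : ⁅s, n⁆ = 0) : ∃ h : L, ⁅h, s⁆ = 0 ∧ ⁅h, n⁆ = n := by
  set κ := killingForm F L with hκ
  have hinv : ∀ x y z : L, κ ⁅x, y⁆ z = κ x ⁅y, z⁆ :=
    fun x y z => LieModule.traceForm_apply_lie_apply F L L x y z
  have hnd := LieAlgebra.IsKilling.killingForm_nondegenerate F L
  have hdec : ∀ y : L, ∃ y0 y1 : L, ⁅s, y0⁆ = 0 ∧ y = y0 + ⁅s, y1⁆ := by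
    have : (⊤ : Submodule F L) ≤ LinearMap.ker (LieAlgebra.ad F L s) ⊔
        LinearMap.range (LieAlgebra.ad F L s) := by
      rw [← hs.iSup_eigenspace_eq_top]
      refine iSup_le fun a v hv => ?_
      rw [Module.End.mem_eigenspace_iff] at hv
      by_cases ha : a = 0
      · exact Submodule.mem_sup_left (by simpa [ha] using hv)
      · refine Submodule.mem_sup_right ⟨a⁻¹ • v, ?_⟩
        rw [map_smul, hv, inv_smul_smul₀ ha]
    intro y
    obtain ⟨y0, h0, z, ⟨y1, rfl⟩, rfl⟩ := Submodule.mem_sup.mp (this (Submodule.mem_top (x := y)))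
    exact ⟨y0, y1, by simpa using h0, by simp⟩
  set W := (LinearMap.ker (LieAlgebra.ad F L s)).map (LieAlgebra.ad F L n) with hW
  by_cases hnW : n ∈ W
  · obtain ⟨c, hc, hcn⟩ := hnW
    refine ⟨-c, ?_, ?_⟩
    · have : ⁅s, c⁆ = 0 := by simpa using hc
      rw [← lie_skew]; simp [this]
    · rw [← lie_skew]; simpa using hcn
  exfalso
  obtain ⟨φ, hφn, hφW⟩ := Submodule.exists_le_ker_of_notMem hnW
  obtain ⟨y, hy⟩ : ∃ y, κ y = φ := by
    have := LinearMap.BilinForm.toDual κ hnd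
    exact ⟨(LinearMap.BilinForm.toDual κ hnd).symm φ, by
      ext z
      exact LinearMap.BilinForm.apply_toDual_symm_apply ..⟩
  subst hy
  obtain ⟨y0, y1, h0, rfl⟩ := hdec y
  have hred : ∀ c : L, ⁅s, c⁆ = 0 → κ (y0 + ⁅s, y1⁆) c = κ y0 c := by
    intro c hc
    rw [map_add, LinearMap.add_apply, ← lie_skew s y1, map_neg, LinearMap.neg_apply, hinv, hc]
    simp
  have hz : ⁅y0, n⁆ = 0 := by
    have hcent : ⁅⁅y0, n⁆, s⁆ = 0 := by
      rw [← lie_skew, leibniz_lie, h0, hsn]; simp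
    apply hnd.1
    intro z
    obtain ⟨z0, z1, hz0, rfl⟩ := hdec z
    rw [map_add, ← hinv _ s z1, hcent, hinv, ← hred]
    · have : κ (y0 + ⁅s, y1⁆) ⁅n, z0⁆ = 0 := hφW ⟨z0, by simpa using hz0, by simp⟩
      rw [this]; simp
    · rw [leibniz_lie, hsn, hz0]; simp
  apply hφn
  rw [hred n hsn, hκ, killingForm_apply_apply]
  refine (LinearMap.isNilpotent_trace_of_isNilpotent (Commute.isNilpotent_mul_left ?_ hn)).eq_zero
  show _ * _ = _ * _
  ext z
  simp only [Module.End.mul_apply, LieAlgebra.ad_apply]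
  rw [leibniz_lie, hz, zero_lie, zero_add]

theorem fg_proj (F : Type*) [Field F] (L : Type*) [AddCommGroup L] [Module F L]
    (G : Type*) [DecidableEq G] (H : G → Submodule F L) (hH : DirectSum.IsInternal H) :
    ∃ P : G → L →ₗ[F] L, (∀ k z, P k z ∈ H k) ∧ (∀ k, ∀ z ∈ H k, P k z = z) ∧
      (∀ j k, j ≠ k → ∀ z ∈ H j, P k z = 0) := by
  refine ⟨fun k => (H k).subtype ∘ₗ DirectSum.component F G (fun i => H i) k ∘ₗ
    (LinearEquiv.ofBijective (DirectSum.coeLinearMap H) hH).symm.toLinearMap, ?_, ?_, ?_⟩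
  · intro k z
    exact Subtype.property _
  · intro k z hz
    exact congrArg Subtype.val (hH.ofBijective_coeLinearMap_of_mem hz)
  · intro j k hjk z hz
    exact congrArg Subtype.val (hH.ofBijective_coeLinearMap_of_mem_ne hjk hz)

theorem fg_refine (F : Type*) [Field F] [IsAlgClosed F]
    (L : Type*) [LieRing L] [LieAlgebra F L] [FiniteDimensional F L]
    (G : Type*) [AddCommGroup G] [DecidableEq G]
    (H : G → Submodule F L)
    (hdecomp : DirectSum.IsInternal H)
    (hbracket : ∀ g h : G, ∀ x ∈ H g, ∀ y ∈ H h, ⁅x, y⁆ ∈ H (g + h))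
    (hfine : ∀ (G' : Type) [AddCommGroup G'] [DecidableEq G']
        (H' : G' → Submodule F L),
        DirectSum.IsInternal H' →
        (∀ g h : G', ∀ x ∈ H' g, ∀ y ∈ H' h, ⁅x, y⁆ ∈ H' (g + h)) →
        (∀ g : G, H g ≠ ⊥ → ∃ S : Set G', H g = ⨆ g' ∈ S, H' g') →
        {N : Submodule F L | N ≠ ⊥ ∧ ∃ g', H' g' = N} =
          {N : Submodule F L | N ≠ ⊥ ∧ ∃ g, H g = N})
    (h : L) (hh : h ∈ H 0) (g : G) (s n : L) (hs : s ∈ H g) (hn : n ∈ H g)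
    (hhs : ⁅h, s⁆ = 0) (hhn : ⁅h, n⁆ = n) (hs0 : s ≠ 0) : n = 0 := by
  classical
  obtain ⟨P, hP1, hP2, hP3⟩ := fg_proj F L G H hdecomp
  set E : F → Submodule F L := fun a => (LieAlgebra.ad F L h).maxGenEigenspace a with hE
  have hEind : iSupIndep E := (LieAlgebra.ad F L h).independent_maxGenEigenspace
  have hElie : ∀ a b : F, ∀ x ∈ E a, ∀ y ∈ E b, ⁅x, y⁆ ∈ E (a + b) :=
    fun a b x hx y hy => LieModule.lie_mem_maxGenEigenspace_toEnd (M := L) hx hy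
  have hHE : ∀ k, H k = ⨆ a, H k ⊓ E a := by
    intro k
    refine Submodule.eq_iSup_inf_genEigenspace ⊤ ?_
      (LieAlgebra.ad F L h).iSup_maxGenEigenspace_eq_top
    intro y hy
    simpa using hbracket 0 k h hh y hy
  set K : G × F → Submodule F L := fun p => H p.1 ⊓ E p.2 with hK
  have hKind : iSupIndep K := by
    rintro ⟨k, a⟩
    rw [Submodule.disjoint_def]
    intro v hv hv'
    have hle : (⨆ j, ⨆ (_ : j ≠ (k, a)), K j) ≤ (⨆ b, ⨆ (_ : b ≠ a), E b).comap (P k) := by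
      refine iSup₂_le ?_
      rintro ⟨j, b⟩ hjb w ⟨hw1, hw2⟩
      rw [Submodule.mem_comap]
      by_cases hj : j = k
      · subst hj
        rw [hP2 j w hw1]
        have hb : b ≠ a := fun hb => hjb (by rw [hb])
        exact (le_iSup₂_of_le (f := fun b (_ : b ≠ a) => E b) b hb le_rfl) hw2
      · rw [hP3 j k hj w hw1]
        exact Submodule.zero_mem _
    have hv2 := hle hv'
    rw [Submodule.mem_comap, hP2 k v hv.1] at hv2
    exact (Submodule.disjoint_def.mp (hEind a)) v hv.2 hv2
  have hKtop : ⨆ p, K p = ⊤ := by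
    rw [iSup_prod, ← hdecomp.submodule_iSup_eq_top]
    exact iSup_congr fun k => (hHE k).symm
  have hKlie : ∀ p q : G × F, ∀ x ∈ K p, ∀ y ∈ K q, ⁅x, y⁆ ∈ K (p + q) :=
    fun p q x hx y hy => ⟨hbracket _ _ x hx.1 y hy.1, hElie _ _ x hx.2 y hy.2⟩
  have hfinite : {p | K p ≠ ⊥}.Finite := WellFoundedGT.finite_ne_bot_of_iSupIndep hKind
  obtain ⟨N, e, he⟩ : ∃ (N : ℕ) (e : Fin N → G × F), ∀ p, K p ≠ ⊥ → ∃ i, e i = p := by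
    refine ⟨hfinite.toFinset.card, fun i => (hfinite.toFinset.equivFin.symm i : G × F), ?_⟩
    intro p hp
    exact ⟨hfinite.toFinset.equivFin ⟨p, by simpa using hp⟩, by simp⟩
  let φ : (Fin N → ℤ) →+ G × F :=
    { toFun := fun c => ∑ i, c i • e i
      map_zero' := by simp
      map_add' := fun c d => by simp [add_smul, Finset.sum_add_distrib] }
  let ι : ((Fin N → ℤ) ⧸ φ.ker) →+ G × F := QuotientAddGroup.kerLift φ
  have hι : Function.Injective ι := QuotientAddGroup.kerLift_injective φ
  have hιe : ∀ p, K p ≠ ⊥ → ∃ a, ι a = p := by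
    intro p hp
    obtain ⟨i, rfl⟩ := he p hp
    refine ⟨QuotientAddGroup.mk (Pi.single i 1), ?_⟩
    show φ (Pi.single i 1) = e i
    simp [φ, Pi.single_apply]
  have hfin := hfine ((Fin N → ℤ) ⧸ φ.ker) (fun a => K (ι a)) ?_ ?_ ?_
  · have hsE : s ∈ E 0 := by
      rw [hE, Module.End.mem_maxGenEigenspace]
      exact ⟨1, by simpa using hhs⟩
    have hnE : n ∈ E 1 := by
      rw [hE, Module.End.mem_maxGenEigenspace]
      exact ⟨1, by simp [hhn]⟩
    have hsK : s ∈ K (g, 0) := ⟨hs, hsE⟩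
    have hne : K (g, 0) ≠ ⊥ := fun hb => hs0 (by rw [hb] at hsK; simpa using hsK)
    obtain ⟨a, ha⟩ := hιe _ hne
    have hmem : K (g, 0) ∈ {N : Submodule F L | N ≠ ⊥ ∧ ∃ g, H g = N} := by
      rw [← hfin]
      exact ⟨hne, a, by rw [ha]⟩
    obtain ⟨-, k, hk⟩ := hmem
    have hkg : k = g := by
      by_contra hkg
      apply hs0
      rw [← hP2 g s hs]
      exact hP3 k g hkg s (hk ▸ hsK)
    subst hkg
    have hnE0 : n ∈ E 0 := by
      have : n ∈ K (k, 0) := hk ▸ hn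
      exact this.2
    exact (Submodule.disjoint_def.mp (hEind.pairwiseDisjoint (zero_ne_one (α := F)))) n hnE0 hnE
  · apply DirectSum.isInternal_submodule_of_iSupIndep_of_iSup_eq_top
    · exact hKind.comp hι
    · rw [eq_top_iff, ← hKtop]
      refine iSup_le fun p => ?_
      by_cases hp : K p = ⊥
      · simp [hp]
      · obtain ⟨a, rfl⟩ := hιe p hp
        exact le_iSup (fun a => K (ι a)) a
  · intro a b x hx y hy
    show _ ∈ K (ι (a + b))
    rw [map_add]
    exact hKlie _ _ x hx y hy
  · intro k _
    refine ⟨{a | (ι a).1 = k}, le_antisymm ?_ ?_⟩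
    · conv_lhs => rw [hHE k]
      refine iSup_le fun b => ?_
      by_cases hp : K (k, b) = ⊥
      · have : H k ⊓ E b = ⊥ := hp
        simp [this]
      · obtain ⟨a, ha⟩ := hιe _ hp
        have h1 : H k ⊓ E b = K (ι a) := by rw [ha]
        rw [h1]
        exact le_iSup₂_of_le (f := fun a (_ : a ∈ {a | (ι a).1 = k}) => K (ι a)) a
          (by show (ι a).1 = k; rw [ha]) le_rfl
    · refine iSup₂_le fun a ha => ?_
      have : (ι a).1 = k := ha
      exact this ▸ inf_le_left



/-- In a fine grading of a finite-dimensional simple Lie algebra over an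
algebraically closed field of characteristic zero, every homogeneous element is either
ad-semisimple or ad-nilpotent. -/
theorem fine_grading_homogeneous_semisimple_or_nilpotent
    (F : Type*) [Field F] [IsAlgClosed F] [CharZero F]
    (L : Type*) [LieRing L] [LieAlgebra F L] [FiniteDimensional F L]
    [LieAlgebra.IsSimple F L]
    (G : Type*) [AddCommGroup G] [DecidableEq G]
    (H : G → Submodule F L)
    (hdecomp : DirectSum.IsInternal H)
    (hbracket : ∀ g h : G, ∀ x ∈ H g, ∀ y ∈ H h, ⁅x, y⁆ ∈ H (g + h))
    (hfine : ∀ (G' : Type) [AddCommGroup G'] [DecidableEq G']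
        (H' : G' → Submodule F L),
        DirectSum.IsInternal H' →
        (∀ g h : G', ∀ x ∈ H' g, ∀ y ∈ H' h, ⁅x, y⁆ ∈ H' (g + h)) →
        (∀ g : G, H g ≠ ⊥ → ∃ S : Set G', H g = ⨆ g' ∈ S, H' g') →
        {N : Submodule F L | N ≠ ⊥ ∧ ∃ g', H' g' = N} =
          {N : Submodule F L | N ≠ ⊥ ∧ ∃ g, H g = N}) :
    ∀ g : G, ∀ x ∈ H g,
      Module.End.IsSemisimple (LieAlgebra.ad F L x) ∨
        IsNilpotent (LieAlgebra.ad F L x) := by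
  intro g x hx
  have hpow : ∀ (j : ℕ) (k : G), ∀ y ∈ H k, ((LieAlgebra.ad F L x) ^ j) y ∈ H (k + j • g) := by
    intro j
    induction j with
    | zero => intro k y hy; simpa using hy
    | succ j ih =>
      intro k y hy
      rw [pow_succ', Module.End.mul_apply, LieAlgebra.ad_apply]
      have := hbracket _ _ x hx _ (ih k y hy)
      rwa [show g + (k + j • g) = k + (j + 1) • g by rw [add_smul, one_smul]; abel] at this
  have htopH : ∀ p : Submodule F L, (∀ k, H k ≤ p) → p = ⊤ := by
    intro p hp
    rw [eq_top_iff, ← hdecomp.submodule_iSup_eq_top]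
    exact iSup_le hp
  by_cases hm : addOrderOf g = 0
  · right
    have hfinite : {k | H k ≠ ⊥}.Finite :=
      WellFoundedGT.finite_ne_bot_of_iSupIndep hdecomp.submodule_iSupIndep
    have h0 : (LieAlgebra.ad F L x).maxGenEigenspace 0 = ⊤ := by
      apply htopH
      intro k y hy
      rw [Module.End.mem_maxGenEigenspace]
      have hinj : Function.Injective (fun j : ℕ => k + j • g) := by
        intro i j hij
        exact (injective_nsmul_iff_not_isOfFinAddOrder.mpr (addOrderOf_eq_zero_iff.mp hm))
          (add_left_cancel hij)
      obtain ⟨j, hj⟩ : ∃ j : ℕ, H (k + j • g) = ⊥ := by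
        by_contra! hcon
        exact Set.infinite_of_injective_forall_mem hinj (s := {k | H k ≠ ⊥}) hcon hfinite
      refine ⟨j, ?_⟩
      have := hpow j k y hy
      rw [hj] at this
      simpa using this
    refine ⟨Module.finrank F L, ?_⟩
    rw [Module.End.maxGenEigenspace_eq_genEigenspace_finrank, Module.End.genEigenspace_nat,
      LinearMap.ker_eq_top] at h0
    simpa using h0
  obtain ⟨q, hqm, hqS, hqss, hqnil⟩ := fg_jordan F L (LieAlgebra.ad F L x) (addOrderOf g) hm
  set S := Polynomial.aeval (LieAlgebra.ad F L x) q with hS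
  have hSH : ∀ k, ∀ y ∈ H k, S y ∈ H (k + g) := by
    intro k y hy
    rw [hS, Polynomial.aeval_eq_sum_range, LinearMap.sum_apply]
    refine Submodule.sum_mem _ fun i _ => ?_
    by_cases hi : q.coeff i = 0
    · simp [hi]
    · rw [LinearMap.smul_apply]
      apply Submodule.smul_mem
      have h1 := hpow i k y hy
      have h2 : i • g = 1 • g := nsmul_eq_nsmul_iff_modEq.mpr (hqm i hi)
      rwa [h2, one_smul] at h1
  have htopE : ∀ p : Submodule F L,
      (∀ a, (LieAlgebra.ad F L x).maxGenEigenspace a ≤ p) → ∀ y, y ∈ p := by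
    intro p hp y
    have : (⊤ : Submodule F L) ≤ p := by
      rw [← (LieAlgebra.ad F L x).iSup_maxGenEigenspace_eq_top]
      exact iSup_le hp
    exact this Submodule.mem_top
  have hSder : ∀ y z, S ⁅y, z⁆ = ⁅y, S z⁆ - ⁅z, S y⁆ := by
    intro y z
    let A : L →ₗ[F] L →ₗ[F] L := (LieModule.toEnd F L L : L →ₗ[F] Module.End F L)
    let B : L →ₗ[F] L →ₗ[F] L := A.compr₂ S - (A.compl₂ S - (A.compl₂ S).flip)
    have hB : ∀ y z, B y z = S ⁅y, z⁆ - (⁅y, S z⁆ - ⁅z, S y⁆) := fun y z => rfl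
    suffices B y z = 0 by rwa [hB, sub_eq_zero] at this
    refine htopE (LinearMap.ker (B.flip z)) ?_ y
    intro a y hy
    refine htopE (LinearMap.ker (B y)) ?_ z
    intro b z hz
    rw [LinearMap.mem_ker, hB, hqS a y hy, hqS b z hz,
      hqS (a + b) _ (LieModule.lie_mem_maxGenEigenspace_toEnd (M := L) hy hz),
      lie_smul, lie_smul, ← lie_skew y z, add_smul]
    module
  obtain ⟨s', hs'⟩ := LieDerivation.IsKilling.exists_eq_ad (R := F) (L := L) ⟨S, hSder⟩
  have hs'S : ∀ y, ⁅s', y⁆ = S y := fun y => by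
    have h1 : LieDerivation.ad F L s' y = S y := congrArg (fun D => D y) hs'
    simpa using h1
  obtain ⟨P, hP1, hP2, hP3⟩ := fg_proj F L G H hdecomp
  have hPlie : ∀ j k, ∀ t ∈ H j, ∀ z, ⁅P k z, t⁆ = P (k + j) ⁅z, t⁆ := by
    intro j k t ht z
    let A : L →ₗ[F] L := (LieModule.toEnd F L L : L →ₗ[F] Module.End F L).flip t
    let B : L →ₗ[F] L := A ∘ₗ P k - P (k + j) ∘ₗ A
    have hB : ∀ z, B z = ⁅P k z, t⁆ - P (k + j) ⁅z, t⁆ := fun z => rfl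
    suffices z ∈ LinearMap.ker B by rwa [LinearMap.mem_ker, hB, sub_eq_zero] at this
    rw [htopH (LinearMap.ker B)]
    · trivial
    intro i z hz
    rw [LinearMap.mem_ker, hB, sub_eq_zero]
    by_cases hik : i = k
    · subst hik
      rw [hP2 i z hz, hP2 _ _ (hbracket _ _ z hz t ht)]
    · rw [hP3 i k hik z hz, hP3 (i + j) (k + j) (fun hc => hik (add_right_cancel hc)) _
        (hbracket _ _ z hz t ht), zero_lie]
  obtain ⟨s, hsg, hsS⟩ : ∃ s ∈ H g, LieAlgebra.ad F L s = S := by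
    refine ⟨P g s', hP1 g s', ?_⟩
    rw [← sub_eq_zero, ← LinearMap.ker_eq_top]
    apply htopH
    intro j t ht
    rw [LinearMap.mem_ker, LinearMap.sub_apply, LieAlgebra.ad_apply, hPlie j g t ht, hs'S,
      hP2 _ _ (by rw [add_comm]; exact hSH j t ht), sub_self]
  have hnnil : IsNilpotent (LieAlgebra.ad F L (x - s)) := by
    rwa [map_sub, hsS]
  have hxE : x ∈ (LieAlgebra.ad F L x).maxGenEigenspace 0 := by
    rw [Module.End.mem_maxGenEigenspace]
    exact ⟨1, by simp⟩
  have hsx : ⁅s, x - s⁆ = 0 := by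
    rw [lie_sub, lie_self, sub_zero, ← LieAlgebra.ad_apply F L, hsS, hqS 0 x hxE, zero_smul]
  by_cases hs0 : s = 0
  · right
    simpa [hs0] using hnnil
  left
  obtain ⟨h, hhs, hhn⟩ := fg_exists_h F L s (x - s) (by rwa [hsS]) hnnil hsx
  have hng : x - s ∈ H g := Submodule.sub_mem _ hx hsg
  have hx0 : x - s = 0 := by
    refine fg_refine F L G H hdecomp hbracket hfine (P 0 h) (hP1 0 h) g s (x - s) hsg hng ?_ ?_ hs0
    · rw [hPlie g 0 s hsg, hhs, map_zero]
    · rw [hPlie g 0 _ hng, hhn, zero_add, hP2 g _ hng]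
  rw [sub_eq_zero.mp hx0, hsS]
  exact hqss
end

section
/- The group W (the Weyl group of F₄, of order 1152) has exactly 25 conjugacy classes. Its elements have orders 1, 2, 3, 4, 6, 8 or 12 only, and the number of elements of order 1, 2, 3, 4, 6, 8, 12 is respectively 1, 139, 80, 228, 464, 144, 96; moreover the number of conjugacy classes consisting of elements of order 1, 2, 3, 4, 6, 8, 12 is respectively 1, 7, 3, 5, 7, 1, 1. -/
noncomputable section

/-- The simple reflection `s₁` of the `F₄` Weyl group. -/
def s1 : Matrix (Fin 4) (Fin 4) ℚ := !![-1, 0, 0, 0; 1, 1, 0, 0; 0, 0, 1, 0; 0, 0, 0, 1]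

/-- The simple reflection `s₂` of the `F₄` Weyl group. -/
def s2 : Matrix (Fin 4) (Fin 4) ℚ := !![1, 1, 0, 0; 0, -1, 0, 0; 0, 1, 1, 0; 0, 0, 0, 1]

/-- The simple reflection `s₃` of the `F₄` Weyl group. -/
def s3 : Matrix (Fin 4) (Fin 4) ℚ := !![1, 0, 0, 0; 0, 1, 2, 0; 0, 0, -1, 0; 0, 0, 1, 1]

/-- The simple reflection `s₄` of the `F₄` Weyl group. -/
def s4 : Matrix (Fin 4) (Fin 4) ℚ := !![1, 0, 0, 0; 0, 1, 0, 0; 0, 0, 1, 1; 0, 0, 0, -1]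

/-- The Weyl group of `F₄`: the subgroup of `GL(4,ℚ)` generated by `s₁, s₂, s₃, s₄`. -/
def Wgrp : Subgroup (Matrix.GeneralLinearGroup (Fin 4) ℚ) :=
  Subgroup.closure
    {g | (g : Matrix (Fin 4) (Fin 4) ℚ) = s1 ∨ (g : Matrix (Fin 4) (Fin 4) ℚ) = s2 ∨
      (g : Matrix (Fin 4) (Fin 4) ℚ) = s3 ∨ (g : Matrix (Fin 4) (Fin 4) ℚ) = s4}

/-! ### Integer matrices as tuples, and their codes -/

/-- A `4 × 4` integer matrix, row by row. -/
structure F4T where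
  (a b c d e f g h i j k l m n o p : ℤ)

/-- The rational matrix of a tuple. -/
def F4T.mat : F4T → Matrix (Fin 4) (Fin 4) ℚ
  | ⟨a, b, c, d, e, f, g, h, i, j, k, l, m, n, o, p⟩ =>
    !![(a : ℚ), b, c, d; e, f, g, h; i, j, k, l; m, n, o, p]

def F4T.one : F4T := ⟨1, 0, 0, 0, 0, 1, 0, 0, 0, 0, 1, 0, 0, 0, 0, 1⟩

/-- Left multiplication by `s₁`, …, `s₄`. -/
def F4T.l1 : F4T → F4T
  | ⟨a, b, c, d, e, f, g, h, i, j, k, l, m, n, o, p⟩ =>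
    ⟨-a, -b, -c, -d, a + e, b + f, c + g, d + h, i, j, k, l, m, n, o, p⟩

def F4T.l2 : F4T → F4T
  | ⟨a, b, c, d, e, f, g, h, i, j, k, l, m, n, o, p⟩ =>
    ⟨a + e, b + f, c + g, d + h, -e, -f, -g, -h, e + i, f + j, g + k, h + l, m, n, o, p⟩

def F4T.l3 : F4T → F4T
  | ⟨a, b, c, d, e, f, g, h, i, j, k, l, m, n, o, p⟩ =>
    ⟨a, b, c, d, e + (i + i), f + (j + j), g + (k + k), h + (l + l), -i, -j, -k, -l,
      i + m, j + n, k + o, l + p⟩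

def F4T.l4 : F4T → F4T
  | ⟨a, b, c, d, e, f, g, h, i, j, k, l, m, n, o, p⟩ =>
    ⟨a, b, c, d, e, f, g, h, i + m, j + n, k + o, l + p, -m, -n, -o, -p⟩

/-- Right multiplication by `s₁`, …, `s₄`. -/
def F4T.r1 : F4T → F4T
  | ⟨a, b, c, d, e, f, g, h, i, j, k, l, m, n, o, p⟩ =>
    ⟨-a + b, b, c, d, -e + f, f, g, h, -i + j, j, k, l, -m + n, n, o, p⟩

def F4T.r2 : F4T → F4T
  | ⟨a, b, c, d, e, f, g, h, i, j, k, l, m, n, o, p⟩ =>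
    ⟨a, a + -b + c, c, d, e, e + -f + g, g, h, i, i + -j + k, k, l, m, m + -n + o, o, p⟩

def F4T.r3 : F4T → F4T
  | ⟨a, b, c, d, e, f, g, h, i, j, k, l, m, n, o, p⟩ =>
    ⟨a, b, b + b + -c + d, d, e, f, f + f + -g + h, h, i, j, j + j + -k + l, l,
      m, n, n + n + -o + p, p⟩

def F4T.r4 : F4T → F4T
  | ⟨a, b, c, d, e, f, g, h, i, j, k, l, m, n, o, p⟩ =>
    ⟨a, b, c, c + -d, e, f, g, g + -h, i, j, k, k + -l, m, n, o, o + -p⟩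

/-- The product of two integer matrices. -/
def F4T.mul : F4T → F4T → F4T
  | ⟨a, b, c, d, e, f, g, h, i, j, k, l, m, n, o, p⟩,
    ⟨a₂, b₂, c₂, d₂, e₂, f₂, g₂, h₂, i₂, j₂, k₂, l₂, m₂, n₂, o₂, p₂⟩ =>
    ⟨a * a₂ + b * e₂ + c * i₂ + d * m₂, a * b₂ + b * f₂ + c * j₂ + d * n₂,
      a * c₂ + b * g₂ + c * k₂ + d * o₂, a * d₂ + b * h₂ + c * l₂ + d * p₂,
      e * a₂ + f * e₂ + g * i₂ + h * m₂, e * b₂ + f * f₂ + g * j₂ + h * n₂,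
      e * c₂ + f * g₂ + g * k₂ + h * o₂, e * d₂ + f * h₂ + g * l₂ + h * p₂,
      i * a₂ + j * e₂ + k * i₂ + l * m₂, i * b₂ + j * f₂ + k * j₂ + l * n₂,
      i * c₂ + j * g₂ + k * k₂ + l * o₂, i * d₂ + j * h₂ + k * l₂ + l * p₂,
      m * a₂ + n * e₂ + o * i₂ + p * m₂, m * b₂ + n * f₂ + o * j₂ + p * n₂,
      m * c₂ + n * g₂ + o * k₂ + p * o₂, m * d₂ + n * h₂ + o * l₂ + p * p₂⟩

theorem F4T.mat_injective : Function.Injective F4T.mat := by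
  rintro ⟨a, b, c, d, e, f, g, h, i, j, k, l, m, n, o, p⟩
    ⟨a₂, b₂, c₂, d₂, e₂, f₂, g₂, h₂, i₂, j₂, k₂, l₂, m₂, n₂, o₂, p₂⟩ hh
  simp only [F4T.mat] at hh
  have H := fun x y => congrFun (congrFun hh x) y
  have h00 := H 0 0
  have h01 := H 0 1
  have h02 := H 0 2
  have h03 := H 0 3
  have h10 := H 1 0
  have h11 := H 1 1
  have h12 := H 1 2
  have h13 := H 1 3
  have h20 := H 2 0
  have h21 := H 2 1
  have h22 := H 2 2
  have h23 := H 2 3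
  have h30 := H 3 0
  have h31 := H 3 1
  have h32 := H 3 2
  have h33 := H 3 3
  clear H hh
  simp at h00 h01 h02 h03 h10 h11 h12 h13 h20 h21 h22 h23 h30 h31 h32 h33
  subst_vars
  rfl

theorem F4T.mat_one : F4T.one.mat = 1 := by
  ext x y
  fin_cases x <;> fin_cases y <;> simp [F4T.one, F4T.mat]

theorem F4T.mat_l1 (t : F4T) : t.l1.mat = s1 * t.mat := by
  obtain ⟨a, b, c, d, e, f, g, h, i, j, k, l, m, n, o, p⟩ := t
  ext x y
  fin_cases x <;> fin_cases y <;>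
    simp [F4T.l1, F4T.mat, s1, Matrix.mul_apply, Fin.sum_univ_four]

theorem F4T.mat_l2 (t : F4T) : t.l2.mat = s2 * t.mat := by
  obtain ⟨a, b, c, d, e, f, g, h, i, j, k, l, m, n, o, p⟩ := t
  ext x y
  fin_cases x <;> fin_cases y <;>
    simp [F4T.l2, F4T.mat, s2, Matrix.mul_apply, Fin.sum_univ_four]

theorem F4T.mat_l3 (t : F4T) : t.l3.mat = s3 * t.mat := by
  obtain ⟨a, b, c, d, e, f, g, h, i, j, k, l, m, n, o, p⟩ := t
  ext x y
  fin_cases x <;> fin_cases y <;>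
    simp [F4T.l3, F4T.mat, s3, Matrix.mul_apply, Fin.sum_univ_four, two_mul]

theorem F4T.mat_l4 (t : F4T) : t.l4.mat = s4 * t.mat := by
  obtain ⟨a, b, c, d, e, f, g, h, i, j, k, l, m, n, o, p⟩ := t
  ext x y
  fin_cases x <;> fin_cases y <;>
    simp [F4T.l4, F4T.mat, s4, Matrix.mul_apply, Fin.sum_univ_four]

theorem F4T.mat_r1 (t : F4T) : t.r1.mat = t.mat * s1 := by
  obtain ⟨a, b, c, d, e, f, g, h, i, j, k, l, m, n, o, p⟩ := t
  ext x y
  fin_cases x <;> fin_cases y <;>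
    simp [F4T.r1, F4T.mat, s1, Matrix.mul_apply, Fin.sum_univ_four]

theorem F4T.mat_r2 (t : F4T) : t.r2.mat = t.mat * s2 := by
  obtain ⟨a, b, c, d, e, f, g, h, i, j, k, l, m, n, o, p⟩ := t
  ext x y
  fin_cases x <;> fin_cases y <;>
    simp [F4T.r2, F4T.mat, s2, Matrix.mul_apply, Fin.sum_univ_four]

theorem F4T.mat_r3 (t : F4T) : t.r3.mat = t.mat * s3 := by
  obtain ⟨a, b, c, d, e, f, g, h, i, j, k, l, m, n, o, p⟩ := t
  ext x y
  fin_cases x <;> fin_cases y <;>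
    simp [F4T.r3, F4T.mat, s3, Matrix.mul_apply, Fin.sum_univ_four, mul_two]

theorem F4T.mat_r4 (t : F4T) : t.r4.mat = t.mat * s4 := by
  obtain ⟨a, b, c, d, e, f, g, h, i, j, k, l, m, n, o, p⟩ := t
  ext x y
  fin_cases x <;> fin_cases y <;>
    simp [F4T.r4, F4T.mat, s4, Matrix.mul_apply, Fin.sum_univ_four]

theorem F4T.mat_mul (t u : F4T) : (t.mul u).mat = t.mat * u.mat := by
  obtain ⟨a, b, c, d, e, f, g, h, i, j, k, l, m, n, o, p⟩ := t
  obtain ⟨a₂, b₂, c₂, d₂, e₂, f₂, g₂, h₂, i₂, j₂, k₂, l₂, m₂, n₂, o₂, p₂⟩ := u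
  ext x y
  fin_cases x <;> fin_cases y <;>
    simp [F4T.mul, F4T.mat, Matrix.mul_apply, Fin.sum_univ_four]

/-- The digit of an entry: `x + 8`, or `16` if that is negative. -/
def f4dig (x : ℤ) : ℕ :=
  match x + 8 with
  | Int.ofNat n => n
  | Int.negSucc _ => 16

def f4und (n : ℕ) : ℤ := Int.ofNat (n % 16) + -8

/-- The matrix with a given code. -/
def f4dec (n : ℕ) : F4T :=
  ⟨f4und n, f4und (n / 16), f4und (n / 256), f4und (n / 4096), f4und (n / 65536),
    f4und (n / 1048576), f4und (n / 16777216), f4und (n / 268435456), f4und (n / 4294967296),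
    f4und (n / 68719476736), f4und (n / 1099511627776), f4und (n / 17592186044416),
    f4und (n / 281474976710656), f4und (n / 4503599627370496), f4und (n / 72057594037927936),
    f4und (n / 1152921504606846976)⟩

/-- Horner step; the result is marked invalid when the digit is not less than `16`. -/
def f4enc : F4T → ℕ
  | ⟨a, b, c, d, e, f, g, h, i, j, k, l, m, n, o, p⟩ =>
    f4dig a + 16 * (f4dig b + 16 * (f4dig c + 16 * (f4dig d + 16 * (f4dig e + 16 * (f4dig f +
    16 * (f4dig g + 16 * (f4dig h + 16 * (f4dig i + 16 * (f4dig j + 16 * (f4dig k + 16 *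
    (f4dig l + 16 * (f4dig m + 16 * (f4dig n + 16 * (f4dig o + 16 * f4dig p))))))))))))))

def f4small (x : ℤ) : Bool := Nat.blt (f4dig x) 16

def f4rng : F4T → Bool
  | ⟨a, b, c, d, e, f, g, h, i, j, k, l, m, n, o, p⟩ =>
    f4small a && (f4small b && (f4small c && (f4small d && (f4small e && (f4small f &&
    (f4small g && (f4small h && (f4small i && (f4small j && (f4small k && (f4small l &&
    (f4small m && (f4small n && (f4small o && f4small p))))))))))))))

theorem f4und_dig {x : ℤ} (h : f4small x = true) (r : ℕ) : f4und (f4dig x + 16 * r) = x := by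
  unfold f4small at h
  have h₂ : f4dig x < 16 := by simpa using h
  unfold f4dig at h₂ ⊢
  unfold f4und
  rcases hn : x + 8 with n | n
  · rw [hn] at h₂
    simp only at h₂ ⊢
    have : (n + 16 * r) % 16 = n := by omega
    rw [this]
    change (n : ℤ) + -8 = x
    have hn' : x + 8 = (n : ℤ) := hn
    omega
  · rw [hn] at h₂
    simp at h₂

theorem f4dig_div {x : ℤ} (h : f4small x = true) (r : ℕ) : (f4dig x + 16 * r) / 16 = r := by
  unfold f4small at h
  have h₂ : f4dig x < 16 := by simpa using h
  omega

theorem f4dec_eq (n : ℕ) : f4dec n =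
    ⟨f4und n, f4und (n / 16), f4und (n / 16 / 16), f4und (n / 16 / 16 / 16),
    f4und (n / 16 / 16 / 16 / 16), f4und (n / 16 / 16 / 16 / 16 / 16),
    f4und (n / 16 / 16 / 16 / 16 / 16 / 16), f4und (n / 16 / 16 / 16 / 16 / 16 / 16 / 16),
    f4und (n / 16 / 16 / 16 / 16 / 16 / 16 / 16 / 16),
    f4und (n / 16 / 16 / 16 / 16 / 16 / 16 / 16 / 16 / 16),
    f4und (n / 16 / 16 / 16 / 16 / 16 / 16 / 16 / 16 / 16 / 16),
    f4und (n / 16 / 16 / 16 / 16 / 16 / 16 / 16 / 16 / 16 / 16 / 16),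
    f4und (n / 16 / 16 / 16 / 16 / 16 / 16 / 16 / 16 / 16 / 16 / 16 / 16),
    f4und (n / 16 / 16 / 16 / 16 / 16 / 16 / 16 / 16 / 16 / 16 / 16 / 16 / 16),
    f4und (n / 16 / 16 / 16 / 16 / 16 / 16 / 16 / 16 / 16 / 16 / 16 / 16 / 16 / 16),
    f4und (n / 16 / 16 / 16 / 16 / 16 / 16 / 16 / 16 / 16 / 16 / 16 / 16 / 16 / 16 / 16)⟩ := by
  simp only [f4dec, Nat.div_div_eq_div_mul, Nat.reduceMul]

theorem f4dec_enc (t : F4T) (h : f4rng t = true) : f4dec (f4enc t) = t := by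
  revert h
  obtain ⟨a, b, c, d, e, f, g, h, i, j, k, l, m, n, o, p⟩ := t
  intro hyp
  simp only [f4rng, Bool.and_eq_true] at hyp
  obtain ⟨ha, hb, hc, hd, he, hf, hg, hh, hi, hj, hk, hl, hm, hn, ho, hp⟩ := hyp
  obtain ⟨xp, hxp⟩ : ∃ x, x = f4dig p := ⟨_, rfl⟩
  obtain ⟨xo, hxo⟩ : ∃ x, x = f4dig o + 16 * xp := ⟨_, rfl⟩
  obtain ⟨xn, hxn⟩ : ∃ x, x = f4dig n + 16 * xo := ⟨_, rfl⟩
  obtain ⟨xm, hxm⟩ : ∃ x, x = f4dig m + 16 * xn := ⟨_, rfl⟩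
  obtain ⟨xl, hxl⟩ : ∃ x, x = f4dig l + 16 * xm := ⟨_, rfl⟩
  obtain ⟨xk, hxk⟩ : ∃ x, x = f4dig k + 16 * xl := ⟨_, rfl⟩
  obtain ⟨xj, hxj⟩ : ∃ x, x = f4dig j + 16 * xk := ⟨_, rfl⟩
  obtain ⟨xi, hxi⟩ : ∃ x, x = f4dig i + 16 * xj := ⟨_, rfl⟩
  obtain ⟨xh, hxh⟩ : ∃ x, x = f4dig h + 16 * xi := ⟨_, rfl⟩
  obtain ⟨xg, hxg⟩ : ∃ x, x = f4dig g + 16 * xh := ⟨_, rfl⟩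
  obtain ⟨xf, hxf⟩ : ∃ x, x = f4dig f + 16 * xg := ⟨_, rfl⟩
  obtain ⟨xe, hxe⟩ : ∃ x, x = f4dig e + 16 * xf := ⟨_, rfl⟩
  obtain ⟨xd, hxd⟩ : ∃ x, x = f4dig d + 16 * xe := ⟨_, rfl⟩
  obtain ⟨xc, hxc⟩ : ∃ x, x = f4dig c + 16 * xd := ⟨_, rfl⟩
  obtain ⟨xb, hxb⟩ : ∃ x, x = f4dig b + 16 * xc := ⟨_, rfl⟩
  obtain ⟨xa, hxa⟩ : ∃ x, x = f4dig a + 16 * xb := ⟨_, rfl⟩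
  have hE : f4enc ⟨a, b, c, d, e, f, g, h, i, j, k, l, m, n, o, p⟩ = xa := by
    rw [hxa, hxb, hxc, hxd, hxe, hxf, hxg, hxh, hxi, hxj, hxk, hxl, hxm, hxn, hxo, hxp]
    delta f4enc
    rfl
  have ua : f4und xa = a := by rw [hxa, f4und_dig ha]
  have va : xa / 16 = xb := by rw [hxa, f4dig_div ha]
  have ub : f4und xb = b := by rw [hxb, f4und_dig hb]
  have vb : xb / 16 = xc := by rw [hxb, f4dig_div hb]
  have uc : f4und xc = c := by rw [hxc, f4und_dig hc]
  have vc : xc / 16 = xd := by rw [hxc, f4dig_div hc]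
  have ud : f4und xd = d := by rw [hxd, f4und_dig hd]
  have vd : xd / 16 = xe := by rw [hxd, f4dig_div hd]
  have ue : f4und xe = e := by rw [hxe, f4und_dig he]
  have ve : xe / 16 = xf := by rw [hxe, f4dig_div he]
  have uf : f4und xf = f := by rw [hxf, f4und_dig hf]
  have vf : xf / 16 = xg := by rw [hxf, f4dig_div hf]
  have ug : f4und xg = g := by rw [hxg, f4und_dig hg]
  have vg : xg / 16 = xh := by rw [hxg, f4dig_div hg]
  have uh : f4und xh = h := by rw [hxh, f4und_dig hh]
  have vh : xh / 16 = xi := by rw [hxh, f4dig_div hh]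
  have ui : f4und xi = i := by rw [hxi, f4und_dig hi]
  have vi : xi / 16 = xj := by rw [hxi, f4dig_div hi]
  have uj : f4und xj = j := by rw [hxj, f4und_dig hj]
  have vj : xj / 16 = xk := by rw [hxj, f4dig_div hj]
  have uk : f4und xk = k := by rw [hxk, f4und_dig hk]
  have vk : xk / 16 = xl := by rw [hxk, f4dig_div hk]
  have ul : f4und xl = l := by rw [hxl, f4und_dig hl]
  have vl : xl / 16 = xm := by rw [hxl, f4dig_div hl]
  have um : f4und xm = m := by rw [hxm, f4und_dig hm]
  have vm : xm / 16 = xn := by rw [hxm, f4dig_div hm]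
  have un : f4und xn = n := by rw [hxn, f4und_dig hn]
  have vn : xn / 16 = xo := by rw [hxn, f4dig_div hn]
  have uo : f4und xo = o := by rw [hxo, f4und_dig ho]
  have vo : xo / 16 = xp := by rw [hxo, f4dig_div ho]
  have up : f4und xp = p := by
    rw [hxp]
    simpa using f4und_dig hp 0
  rw [hE, f4dec_eq]
  rw [va, vb, vc, vd, ve, vf, vg, vh, vi, vj, vk, vl, vm, vn, vo,
    ua, ub, uc, ud, ue, uf, ug, uh, ui, uj, uk, ul, um, un, uo, up]

theorem f4und_step {a b : ℕ} (h : f4und a = f4und b) (h₂ : a / 16 = b / 16) : a = b := by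
  unfold f4und at h
  have h2 : Int.ofNat (a % 16) = Int.ofNat (b % 16) := by omega
  have h3 : a % 16 = b % 16 := Int.ofNat.inj h2
  omega

theorem f4dec_inj {x y : ℕ} (hx : x < 18446744073709551616) (hy : y < 18446744073709551616)
    (h : f4dec x = f4dec y) : x = y := by
  rw [f4dec_eq, f4dec_eq] at h
  simp only [F4T.mk.injEq] at h
  obtain ⟨ha, hb, hc, hd, he, hf, hg, hh, hi, hj, hk, hl, hm, hn, ho, hp⟩ := h
  refine f4und_step ha (f4und_step hb (f4und_step hc (f4und_step hd (f4und_step he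
    (f4und_step hf (f4und_step hg (f4und_step hh (f4und_step hi (f4und_step hj (f4und_step hk
    (f4und_step hl (f4und_step hm (f4und_step hn (f4und_step ho (f4und_step hp ?_)))))))))))))))
  simp only [Nat.div_div_eq_div_mul, Nat.reduceMul]
  rw [Nat.div_eq_of_lt hx, Nat.div_eq_of_lt hy]

/-! ### The table and its verification -/

/-- Search trees of codes with values. -/
inductive F4Tree where
  | o : F4Tree
  | n : F4Tree → ℕ → ℕ → F4Tree → F4Tree

open F4Tree in
/-- All elements of the group, sorted by code, with their certificates. -/
def f4Tree : F4Tree :=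
  n (n (n (n (n (n (n (n (n (n (n o 7306976632640145545 13582 o) 7306976632640145561 12559 o)
  7306976632640211079 14486 (n o 7306976632640211096 11464 o)) 7306976632641259639 13544 (n (n (n
  o 7306976632641259640 12527 o) 7306977732118218889 14630 o) 7306977732118219417 11562 (n o
  7306977732118284423 15689 o))) 7306977732118284952 10411 (n (n (n (n o 7306977732152886903 12491
  o) 7306977732152886904 11530 o) 7306977800835598489 15657 (n o 7306977800835599017 12435 o))
  7306977800836712567 16471 (n (n o 7306977800836713112 9353 o) 7306977800871315047 13513 (n o
  7306977800871315064 10411 o)))) 7306977805130500248 16439 (n (n (n (n (n o 7306977805130500777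
  11433 o) 7306977805131548792 17737 o) 7306977805131549337 10379 (n o 7306977805166216807 12435
  o)) 7306977805166216823 11433 (n (n o 7306978900313672345 14639 o) 7306978900313672361 13550 (n
  o 7306978900348339831 15656 o))) 7306978900348340376 8292 (n (n (n (n o 7306978900349388391
  14575 o) 7306978900349388920 9351 o) 7306978904608574104 15624 (n o 7306978904608574121 12495
  o)) 7306978904643176056 16655 (n (n o 7306978904643176601 9319 o) 7306978904644290151 13582 (n o
  7306978904644290679 10372 o))))) 7306978973327002264 14518 (n (n (n (n (n (n o
  7306978973327002265 13544 o) 7306978973361604216 15624 o) 7306978973361604745 10372 (n o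
  7306978973361669751 14486 o)) 7306978973361670279 11313 (n (n o 7306980072838629528 13545 o)
  7306980072838629529 12491 (n o 7306980072839678072 14571 o))) 7306980072839678089 11562 (n (n (n
  (n o 7306980072839743607 13513 o) 7306980072839743623 12403 o) 8459862953411774601 14598 (n o
  8459862953411774617 13578 o)) 8459862953411840135 15657 (n (n o 8459862953411840152 12491 o)
  8459862953412888695 14571 (n o 8459862953412888696 13546 o)))) 8459881644539021449 15586 (n (n
  (n (n (n o 8459881644539030169 10533 o) 8459881644539086983 16676 o) 8459881644539095704 9511 (n
  o 8459881645110552183 11559 o)) 8459881645110552184 10501 (n (n o 8459881713256401049 16612 o)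
  8459881713256409769 11502 (n o 8459881713257515127 17640 o))) 8459881713257523864 8367 (n (n (n
  (n o 8459881713828980327 12527 o) 8459881713828980344 9447 o) 8459881717551302808 17672 (n o
  8459881717551311529 10447 o)) 8459881717552351352 18692 (n (n o 8459881717552360089 9479 o)
  8459881718123882087 11470 (n o 8459881718123882103 10447 o)))))) 8459900404383656601 15658 (n (n
  (n (n (n (n (n o 8459900404383656617 14566 o) 8459900404955178615 16619 o) 8459900404955187352
  7402 (n o 8459900404956227175 15594 o)) 8459900404956235896 8272 (n (n o 8459900408678558360
  16651 o) 8459900408678558377 13514 (n o 8459900409250014840 17674 o))) 8459900409250023577 8240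
  (n (n (n (n o 8459900409251128935 14566 o) 8459900409251137655 9482 o) 8459900477396986520 15625
  (n o 8459900477396986521 14571 o)) 8459900477968443000 16651 (n (n o 8459900477968451721 9482 o)
  8459900477968508535 15593 (n o 8459900477968517255 10259 o)))) 8459919169094650008 12559 (n (n
  (n (n (n o 8459919169094650009 11495 o) 8459919169095698552 13575 o) 8459919169095698569 10469
  (n o 8459919169095764087 12527 o)) 8459919169095764103 11438 (n (n o 8531919447938074761 15662
  o) 8531919447938075289 12527 (n o 8531919447938140295 16566 o))) 8531919447938140824 11432 (n (n
  (n (n o 8531919447972742775 13512 o) 8531919447972742776 12495 o) 8531937039587248265 16588 (n o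
  8531937039587256985 11501 o)) 8531937039587313799 17554 (n (n o 8531937039587322520 10356 o)
  8531937040158778999 12436 (n o 8531937040158779000 11469 o))))) 8531939307260775065 17677 (n (n
  (n (n (n (n o 8531939307260783785 12341 o) 8531939307295442551 18676 o) 8531939307295451800 7245
  (n o 8531939307866907751 13485 o)) 8531939307866908280 8323 (n (n o 8531939311555676824 18676 o)
  8531939311555685545 11405 (n o 8531939311590278776 19757 o))) 8531939311590288025 8291 (n (n (n
  (n o 8531939312161809511 12373 o) 8531939312161810039 9325 o) 8531956898909956761 16687 (n o
  8531956898909957289 13486 o)) 8531956899481478775 17704 (n (n o 8531956899481488024 6191 o)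
  8531956899516081255 14532 (n o 8531956899516089976 7303 o)))) 8531956903204858520 17736 (n (n (n
  (n (n o 8531956903204859049 12452 o) 8531956903776315000 18767 o) 8531956903776324249 7271 (n o
  8531956903810983015 13518 o)) 8531956903810991735 8271 (n (n o 8531959170912987800 14575 o)
  8531959170912987801 13511 (n o 8531959171484444280 15591 o))) 8531959171484453001 8325 (n (n (n
  (n o 8531959171484509815 14543 o) 8531959171484518535 9294 o) 8531976763099024024 13549 (n o
  8531976763099024025 12483 o)) 8531976763133625976 14563 (n (n o 8531976763133626505 9345 o)
  8531976763133691511 13517 (n o 8531976763133692039 10348 o))))))) 8536422978845968537 16719 (n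
  (n (n (n (n (n (n (n o 8536422978845969065 13518 o) 8536422978847082615 17736 o)
  8536422978847083160 10372 (n o 8536422978881685095 14543 o)) 8536422978881685112 11431 (n (n o
  8536440570495142041 17645 o) 8536440570495150761 12309 (n o 8536440570496256119 18644 o)))
  8536440570496264856 9325 (n (n (n (n o 8536440571067721319 13517 o) 8536440571067721336 10403 o)
  8536442838168668841 18668 (n o 8536442838168677561 13581 o)) 8536442838204384871 19789 (n (n o
  8536442838204394136 6211 o) 8536442838775850071 14531 (n o 8536442838775850616 7265 o))))
  8536442911181998744 19634 (n (n (n (n (n o 8536442911182007481 10324 o) 8536442911216600696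
  20756 o) 8536442911216609961 7213 (n o 8536442911789179991 11437 o)) 8536442911789180519 8268 (n
  (n o 8536460429817850537 17678 o) 8536460429817851065 14543 (n o 8536460430390421095 18799 o)))
  8536460430390430360 5191 (n (n (n (n o 8536460430425023575 15559 o) 8536460430425032312 6245 o)
  8536460502831180440 18646 (n o 8536460502831180985 11400 o)) 8536460503402636920 19784 (n (n o
  8536460503402646185 6159 o) 8536460503438353495 12463 (n o 8536460503438362215 7214 o)))))
  8536462770539309720 15592 (n (n (n (n (n (n o 8536462770539309737 12527 o) 8536462771110766200
  16612 o) 8536462771110774937 7335 (n o 8536462771111880295 13550 o)) 8536462771111889015 8303 (n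
  (n o 8536480362725345944 14516 o) 8536480362725345961 11501 (n o 8536480362759947896 15565 o)))
  8536480362759948441 8323 (n (n (n (n o 8536480362761061991 12405 o) 8536480362761062519 9357 o)
  8536704449527777432 17704 (n o 8536704449527777961 12463 o)) 8536704449528825976 18735 (n (n o
  8536704449528826521 11399 o) 8536704449563493991 13550 (n o 8536704449563494007 12452 o))))
  8536722041176950936 18676 (n (n (n (n (n o 8536722041176959657 11437 o) 8536722041177999480
  19725 o) 8536722041178008217 10371 (n o 8536722041749530215 12341 o)) 8536722041749530231 11405
  (n (n o 8536724313145313961 19757 o) 8536724313145322682 12451 (n o 8536724313181029991 20748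
  o))) 8536724313181039257 5249 (n (n (n (n o 8536724313752560726 13613 o) 8536724313752561271
  6243 o) 8536724381863742105 20756 (n o 8536724381863750842 11405 o)) 8536724381898409591 21714
  (n (n o 8536724381898418857 6188 o) 8536724382470988886 12404 (n o 8536724382470989415 7245
  o)))))) 8536741904794495657 18767 (n (n (n (n (n (n (n o 8536741904794496186 13479 o)
  8536741905367066215 19758 o) 8536741905367075481 4165 (n o 8536741905401734230 14575 o))
  8536741905401742967 5223 (n (n o 8536741973512923801 19784 o) 8536741973512924346 12431 (n o
  8536741974084445815 20726 o))) 8536741974084455081 5134 (n (n (n (n o 8536741974120162390 13480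
  o) 8536741974120171111 6191 o) 8536744245515954841 14532 (n o 8536744245515954857 13582 o))
  8536744246087476855 15560 (n (n o 8536744246087485592 6223 o) 8536744246088525415 14607 (n o
  8536744246088534136 7303 o)))) 8536761837701991065 13485 (n (n (n (n (n o 8536761837701991081
  12373 o) 8536761837736658551 14484 o) 8536761837736659096 7277 (n o 8536761837737707111 13581
  o)) 8536761837737707640 8323 (n (n o 8608479473372269209 15625 o) 8608479473372269225 14515 (n o
  8608479473406936695 16439 o))) 8608479473406937240 9321 (n (n (n (n o 8608479473407985255 15593
  o) 8608479473407985784 10379 o) 8608498164499516057 18692 (n o 8608498164499524777 13582 o))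
  8608498164534183543 19720 (n (n o 8608498164534192792 8335 o) 8608498165105648743 14543 (n o
  8608498165105649272 9415 o))))) 8608498233216895657 19633 (n (n (n (n (n (n o
  8608498233216904377 14358 o) 8608498233252611687 20694 o) 8608498233252620952 7240 (n o
  8608498233824076887 15560 o)) 8608498233824077432 8356 (n (n o 8608500505219926168 20726 o)
  8608500505219935417 9320 (n o 8608500505220974712 21800 o))) 8608500505220983977 8303 (n (n (n
  (n o 8608500505827107927 10383 o) 8608500505827107943 9358 o) 8608516924344151209 16595 (n o
  8608516924344151225 15593 o)) 8608516924950275175 17737 (n (n o 8608516924950284440 4107 o)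
  8608516924951323735 16619 (n o 8608516924951332984 5162 o)))) 8608519196347181720 17673 (n (n (n
  (n (n o 8608519196347182265 10411 o) 8608519196918638200 18699 o) 8608519196918647465 5194 (n o
  8608519196954354775 11530 o)) 8608519196954363495 6214 (n (n o 8608519265065609880 16471 o)
  8608519265065610409 11401 (n o 8608519265637066360 17705 o))) 8608519265637075609 6187 (n (n (n
  (n o 8608519265671734375 12435 o) 8608519265671743095 7241 o) 8608537956763273368 15592 (n o
  8608537956763273897 10436 o)) 8608537956764321912 16623 (n (n o 8608537956764322457 9415 o)
  8608537956798989927 11438 (n o 8608537956798989943 10415 o)))))))) 8608760944054078104 16407 (n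
  (n (n (n (n (n (n (n (n o 8608760944054078121 13513 o) 8608760944088680056 17705 o)
  8608760944088680601 10347 (n o 8608760944089794151 14515 o)) 8608760944089794679 11401 (n (n o
  8608779635181324952 19752 o) 8608779635181333673 12463 (n o 8608779635215926904 20772 o)))
  8608779635215936153 9447 (n (n (n (n o 8608779635787457639 13550 o) 8608779635787458167 10415 o)
  8608779708193540777 20726 (n o 8608779708193549498 13480 o)) 8608779708229256807 21713 (n (n o
  8608779708229266073 6340 o) 8608779708800787542 14390 (n o 8608779708800788087 7272 o))))
  8608781975901669529 21832 (n (n (n (n (n o 8608781975901678778 10351 o) 8608781975902783607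
  22806 o) 8608781975902792873 7278 (n o 8608781976508916822 11400 o)) 8608781976508916839 8335 (n
  (n o 8608798399320796329 17705 o) 8608798399320796346 14539 (n o 8608798399926920295 18675 o)))
  8608798399926929561 3082 (n (n (n (n o 8608798399928034390 15625 o) 8608798399928043639 4139 o)
  8608800667028925081 18731 (n o 8608800667028925626 11498 o)) 8608800667600447095 19753 (n (n o
  8608800667600456361 4134 o) 8608800667636163670 12491 (n o 8608800667636172391 5226 o)))))
  8608800740042255001 15625 (n (n (n (n (n (n o 8608800740042255529 12403 o) 8608800740613777015
  16503 o) 8608800740613786264 5161 (n o 8608800740648379495 13481 o)) 8608800740648388216 6219 (n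
  (n o 8608819431739918489 14543 o) 8608819431739919017 11406 (n o 8608819431741032567 15560 o)))
  8608819431741033112 8335 (n (n (n (n o 8608819431775635047 12516 o) 8608819431775635064 9447 o)
  8613264474963020440 15625 (n o 8613264474963020441 14571 o)) 8613264474997622392 16651 (n (n o
  8613264474997622921 11530 o) 8613264474997687927 15593 (n o 8613264474997688455 12371 o))))
  8613283234807646872 20758 (n (n (n (n (n o 8613283234807655609 11400 o) 8613283234842248824
  21832 o) 8613283234842258089 8271 (n o 8613283235414828119 12463 o)) 8613283235414828647 9326 (n
  (n o 8613283239102483097 21832 o) 8613283239102491834 12431 (n o 8613283239137150583 22838 o)))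
  8613283239137159849 7246 (n (n (n (n o 8613283239709729878 13480 o) 8613283239709730407 8303 o)
  8613285506810611849 22852 (n o 8613285506810621114 9479 o)) 8613285506810677383 23793 (n (n o
  8613285506810686649 8420 o) 8613285507417859158 10500 (n o 8613285507417859159 9479 o))))))
  8613301998947118265 16439 (n (n (n (n (n (n (n o 8613301998947118266 15593 o)
  8613301999554290775 17673 o) 8613301999554300041 2054 (n o 8613301999554356310 16471 o))
  8613301999554365575 3081 (n (n o 8613304266655247017 17737 o) 8613304266655247546 12427 (n o
  8613304267227817575 18675 o))) 8613304267227826841 3114 (n (n (n (n o 8613304267262485590 13513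
  o) 8613304267262494327 4203 o) 8613304270950148777 16595 (n o 8613304270950149305 13481 o))
  8613304271522719335 17705 (n (n o 8613304271522728600 4171 o) 8613304271557321815 14507 (n o
  8613304271557330552 5194 o)))) 8613323031367288969 13582 (n (n (n (n (n o 8613323031367289497
  10447 o) 8613323031367354503 14422 o) 8613323031367355032 9352 (n o 8613323031401956983 11432
  o)) 8613323031401956984 10415 (n (n o 8685320969522874520 14486 o) 8685320969522874521 13576 (n
  o 8685320969523923064 15656 o))) 8685320969523923081 12452 (n (n (n (n o 8685320969523988599
  14454 o) 8685320969523988615 13393 o) 8685340828845574296 21714 (n o 8685340828845583545 10292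
  o)) 8685340828846622840 22836 (n (n o 8685340828846632105 9293 o) 8685340829452756055 11405 (n o
  8685340829452756071 10348 o))))) 8685340833140410521 22836 (n (n (n (n (n (n o
  8685340833140419770 11373 o) 8685340833141524599 23794 o) 8685340833141533865 8268 (n o
  8685340833747657814 12372 o)) 8685340833747657831 9325 (n (n o 8685340901858838665 23794 o)
  8685340901858847930 10260 (n o 8685340901858904199 24600 o))) 8685340901858913465 9234 (n (n (n
  (n o 8685340902466085974 11314 o) 8685340902466085975 10292 o) 8685360692463119545 15688 (n o
  8685360692463119546 14532 o)) 8685360693070292055 16612 (n (n o 8685360693070301321 1090 o)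
  8685360693070357590 15656 (n o 8685360693070366855 2116 o)))) 8685360761181547689 16566 (n (n (n
  (n (n o 8685360761181547706 13544 o) 8685360761787671655 17553 o) 8685360761787680921 2180 (n o
  8685360761788785750 14454 o)) 8685360761788794999 3112 (n (n o 8685360765476449449 15473 o)
  8685360765476449465 14422 (n o 8685360766082573415 16534 o))) 8685360766082582680 3080 (n (n (n
  (n o 8685360766083621975 15624 o) 8685360766083631224 4196 o) 8685380625405216905 12428 (n o
  8685380625405216921 11437 o)) 8685380625405282439 13394 (n (n o 8685380625405282456 10324 o)
  8685380625406330999 12404 (n o 8685380625406331000 11405 o))))))) 9761400977442253465 16655 (n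
  (n (n (n (n (n (n (n o 9761400977442253481 15566 o) 9761400978013775479 17672 o)
  9761400978013784216 8271 (n o 9761400978014824039 16612 o)) 9761400978014832760 9383 (n (n o
  9761402076920326809 17738 o) 9761402076920327337 14534 (n o 9761402077491848823 18699 o)))
  9761402077491858072 7370 (n (n (n (n o 9761402077526451303 15562 o) 9761402077526460024 8240 o)
  9761402145637706409 18675 (n o 9761402145637706937 15561 o)) 9761402146210276967 19785 (n (n o
  9761402146210286232 6187 o) 9761402146244879447 16587 (n o 9761402146244888184 7242 o))))
  9761403245115780265 17646 (n (n (n (n (n o 9761403245115780281 16623 o) 9761403245721904231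
  18767 o) 9761403245721913496 5159 (n o 9761403245722952791 17639 o)) 9761403245722962040 6213 (n
  (n o 9761439601475946648 19753 o) 9761439601475955897 8267 (n o 9761439601476995192 20779 o)))
  9761439601477004457 7338 (n (n (n (n o 9761439602083128407 9386 o) 9761439602083128423 8326 o)
  9761440700954020504 18692 (n o 9761440700954029241 9415 o)) 9761440700988622456 19719 (n (n o
  9761440700988631721 6245 o) 9761440701561201751 10469 (n o 9761440701561202279 7266 o)))))
  9761440769672448664 17704 (n (n (n (n (n (n o 9761440769672457385 10351 o) 9761440769707050616
  18735 o) 9761440769707059865 7239 (n o 9761440770278581351 11438 o)) 9761440770278581879 8292 (n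
  (n o 9761441869184075928 16619 o) 9761441869184084649 9322 (n o 9761441869185124472 17642 o)))
  9761441869185133209 8272 (n (n (n (n o 9761441869756655207 10406 o) 9761441869756655223 9418 o)
  9761682448124062360 17704 (n o 9761682448124062377 14532 o)) 9761682448695518840 18735 (n (n o
  9761682448695527577 9351 o) 9761682448696632935 15598 (n o 9761682448696641655 10351 o))))
  9761683547602135704 18731 (n (n (n (n (n o 9761683547602136233 13482 o) 9761683548173592184
  19754 o) 9761683548173601433 8208 (n o 9761683548208260199 14566 o)) 9761683548208268919 9450 (n
  (n o 9761683620614351529 19785 o) 9761683620614352058 14507 (n o 9761683621186922087 20755 o)))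
  9761683621186931353 5162 (n (n (n (n o 9761683621221590102 15593 o) 9761683621221598839 6219 o)
  9761684720092425385 18735 (n o 9761684720092425402 15559 o)) 9761684720698549351 19726 (n (n o
  9761684720698558617 4133 o) 9761684720699663446 16655 (n o 9761684720699672695 5191 o))))))
  9761721072157690009 20811 (n (n (n (n (n (n (n o 9761721072157699258 9354 o) 9761721072158804087
  21833 o) 9761721072158813353 6246 (n o 9761721072764937302 10347 o)) 9761721072764937319 7370 (n
  (n o 9761722171635763865 19751 o) 9761722171635772602 10437 (n o 9761722171670431351 20772 o)))
  9761722171670440617 5186 (n (n (n (n o 9761722172243010646 11495 o) 9761722172243011175 6277 o)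
  9761722244649093785 16655 (n o 9761722244649102505 11406 o)) 9761722244683761271 17736 (n (n o
  9761722244683770520 6212 o) 9761722245255226471 12431 (n o 9761722245255227000 7271 o))))
  9761723344160721049 15626 (n (n (n (n (n o 9761723344160729769 10374 o) 9761723344161835127
  16587 o) 9761723344161843864 7338 (n o 9761723344733300327 11402 o)) 9761723344733300344 8304 (n
  (n o 9766185979033004696 16655 o) 9766185979033004697 15591 (n o 9766185979604461176 17671 o)))
  9766185979604469897 10405 (n (n (n (n o 9766185979604526711 16623 o) 9766185979604535431 11374
  o) 9766187147228457624 19753 (n o 9766187147228458169 12427 o)) 9766187147799914104 20779 (n (n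
  o 9766187147799923369 7274 o) 9766187147835630679 13546 (n o 9766187147835639399 8294 o)))))
  9766187151523293849 20811 (n (n (n (n (n (n o 9766187151523294394 13514 o) 9766187152094815863
  21833 o) 9766187152094825129 6214 (n o 9766187152130532438 14507 o)) 9766187152130541159 7306 (n
  (n o 9766188319718747321 17736 o) 9766188319718747322 16612 (n o 9766188320325919831 18692 o)))
  9766188320325929097 3106 (n (n (n (n o 9766188320325985366 17736 o) 9766188320325994631 4132 o)
  9766224603066632329 21834 (n o 9766224603066641594 8240 o)) 9766224603066697863 22835 (n (n o
  9766224603066707129 7242 o) 9766224603673879638 9322 (n o 9766224603673879639 8272 o))))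
  9766225771262085801 18767 (n (n (n (n (n o 9766225771262094522 11431 o) 9766225771297801831
  19758 o) 9766225771297811097 4165 (n o 9766225771869332566 12463 o)) 9766225771869333111 5223 (n
  (n o 9766225775556987561 17678 o) 9766225775556996281 12431 (n o 9766225775592703591 18735 o)))
  9766225775592712856 5191 (n (n (n (n o 9766225776164168791 13511 o) 9766225776164169336 6245 o)
  9766226943788091529 14598 (n o 9766226943788100249 9482 o)) 9766226943788157063 15625 (n (n o
  9766226943788165784 8299 o) 9766226944359622263 10379 (n o 9766226944359622264 9450 o)))))))))
  9910300067597232792 15657 (n (n (n (n (n (n (n (n (n (n o 9910300067597232793 14539 o)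
  9910300068168689272 16619 o) 9910300068168697993 9450 (n o 9910300068168754807 15625 o))
  9910300068168763527 10291 (n (n o 9910301235792685720 18678 o) 9910301235792686265 11432 (n o
  9910301236364142200 19784 o))) 9910301236364151465 6191 (n (n (n (n o 9910301236399858775 12495
  o) 9910301236399867495 7246 o) 9910301240087521945 19752 (n o 9910301240087522490 12463 o))
  9910301240659043959 20758 (n (n o 9910301240659053225 5166 o) 9910301240694760534 13512 (n o
  9910301240694769255 6223 o)))) 9910302408282975417 16471 (n (n (n (n (n o 9910302408282975418
  15561 o) 9910302408890147927 17641 o) 9910302408890157193 2086 (n o 9910302408890213462 16503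
  o)) 9910302408890222727 3113 (n (n o 9910338691630860425 20772 o) 9910338691630869690 7399 (n o
  9910338691630925959 21713 o))) 9910338691630935225 6340 (n (n (n (n o 9910338692238107734 8420
  o) 9910338692238107735 7399 o) 9910339859826313897 17705 (n o 9910339859826322618 10347 o))
  9910339859862029927 18675 (n (n o 9910339859862039193 3146 o) 9910339860433560662 11433 (n o
  9910339860433561207 4235 o))))) 9910339864121215657 16595 (n (n (n (n (n (n o
  9910339864121224377 11401 o) 9910339864156931687 17673 o) 9910339864156940952 4203 (n o
  9910339864728396887 12427 o)) 9910339864728397432 5226 (n (n o 9910341032352319625 13614 o)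
  9910341032352328345 8367 (n o 9910341032352385159 14454 o))) 9910341032352393880 7272 (n (n (n
  (n o 9910341032923850359 9352 o) 9910341032923850360 8335 o) 9914803667223554712 16439 (n o
  9914803667223554729 13481 o)) 9914803667795011192 17673 (n (n o 9914803667795019929 8267 o)
  9914803667796125287 14515 (n o 9914803667796134007 9321 o)))) 9914804766701628056 17672 (n (n (n
  (n (n o 9914804766701628585 12495 o) 9914804767273084536 18692 o) 9914804767273093785 7367 (n o
  9914804767307752551 13582 o)) 9914804767307761271 8335 (n (n o 9914804839713843881 18646 o)
  9914804839713844410 13512 (n o 9914804840286414439 19633 o))) 9914804840286423705 4260 (n (n (n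
  (n o 9914804840321082454 14422 o) 9914804840321091191 5192 o) 9914805939191917737 17737 (n o
  9914805939191917754 14507 o)) 9914805939798041703 18643 (n (n o 9914805939798050969 3114 o)
  9914805939799155798 15593 (n o 9914805939799165047 4171 o)))))) 9914842291257182361 19752 (n (n
  (n (n (n (n (n o 9914842291257191610 8271 o) 9914842291258296439 20726 o) 9914842291258305705
  5198 (n o 9914842291864429654 9320 o)) 9914842291864429671 6255 (n (n o 9914843390735256217
  18699 o) 9914843390735264954 9418 (n o 9914843390769923703 19721 o))) 9914843390769932969 4166
  (n (n (n (n o 9914843391342502998 10411 o) 9914843391342503527 5258 o) 9914843463748586137 15657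
  (n o 9914843463748594857 10323 o)) 9914843463783253623 16535 (n (n o 9914843463783262872 5193 o)
  9914843464354718823 11401 (n o 9914843464354719352 6251 o)))) 9914844563260213401 14575 (n (n (n
  (n (n o 9914844563260222121 9326 o) 9914844563261327479 15592 o) 9914844563261336216 6255 (n o
  9914844563832792679 10436 o)) 9914844563832792696 7367 (n (n o 9915085142200199833 15593 o)
  9915085142200199849 14483 (n o 9915085142771721847 16471 o))) 9915085142771730584 7241 (n (n (n
  (n o 9915085142772770407 15561 o) 9915085142772779128 8299 o) 9915086241678273177 16612 (n o
  9915086241678273705 13614 o)) 9915086242249795191 17640 (n (n o 9915086242249804440 6255 o)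
  9915086242284397671 14575 (n o 9915086242284406392 7335 o))))) 9915086310395652777 17553 (n (n
  (n (n (n (n o 9915086310395653305 14390 o) 9915086310968223335 18614 o) 9915086310968232600 5160
  (n o 9915086311002825815 15592 o)) 9915086311002834552 6276 (n (n o 9915087409873726633 16563 o)
  9915087409873726649 15561 (n o 9915087410479850599 17737 o))) 9915087410479859864 4139 (n (n (n
  (n o 9915087410480899159 16587 o) 9915087410480908408 5194 o) 9915123766233893016 18646 (n o
  9915123766233902265 7240 o)) 9915123766234941560 19720 (n (n o 9915123766234950825 6223 o)
  9915123766841074775 8303 (n o 9915123766841074791 7278 o)))) 9915124865711966872 17641 (n (n (n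
  (n (n o 9915124865711975609 8331 o) 9915124865746568824 18667 o) 9915124865746578089 5226 (n o
  9915124866319148119 9450 o)) 9915124866319148647 6246 (n (n o 9915124934430395032 16503 o)
  9915124934430403753 9321 (n o 9915124934464996984 17737 o))) 9915124934465006233 6219 (n (n (n
  (n o 9915124935036527719 10355 o) 9915124935036528247 7273 o) 9915126033942022296 15624 (n o
  9915126033942031017 8356 o)) 9915126033943070840 16655 (n (n o 9915126033943079577 7335 o)
  9915126034514601575 9358 (n o 9915126034514601591 8335 o))))))) 10991146386550524056 13581 (n (n
  (n (n (n (n (n (n o 10991146386550524057 12515 o) 10991146386551572600 14595 o)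
  10991146386551572617 11425 (n o 10991146386551638135 13549 o)) 10991146386551638151 12428 (n (n
  o 10991166245873223832 20772 o) 10991166245873233081 9447 (n o 10991166245874272376 21799 o)))
  10991166245874281641 8325 (n (n (n (n o 10991166246480405591 10437 o) 10991166246480405607 9346
  o) 10991166250168060057 21831 (n o 10991166250168069306 10405 o)) 10991166250169174135 22852 (n
  (n o 10991166250169183401 7266 o) 10991166250775307350 11527 (n o 10991166250775307367 8357
  o)))) 10991166318886488201 22852 (n (n (n (n (n o 10991166318886497466 9479 o)
  10991166318886553735 23793 o) 10991166318886563001 8420 (n o 10991166319493735510 10500 o))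
  10991166319493735511 9479 (n (n o 10991186109490769081 14627 o) 10991186109490769082 13505 (n o
  10991186110097941591 15585 o))) 10991186110097950857 0 (n (n (n (n o 10991186110098007126 14627
  o) 10991186110098016391 1025 o) 10991186178209197225 15661 (n o 10991186178209197242 12515 o))
  10991186178815321191 16588 (n (n o 10991186178815330457 1089 o) 10991186178816435286 13613 (n o
  10991186178816444535 2083 o))))) 10991186182504098985 14508 (n (n (n (n (n (n o
  10991186182504099001 13581 o) 10991186183110222951 15693 o) 10991186183110232216 2051 (n o
  10991186183111271511 14595 o)) 10991186183111280760 3105 (n (n o 10991206042432866441 11426 o)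
  10991206042432866457 10469 (n o 10991206042432931975 12580 o))) 10991206042432931992 9511 (n (n
  (n (n o 10991206042433980535 11559 o) 10991206042433980536 10437 o) 11063203980554898072 14639
  (n o 11063203980554898073 13575 o)) 11063203980589500024 15655 (n (n o 11063203980589500553
  10437 o) 11063203980589565559 14607 (n o 11063203980589566087 11406 o)))) 11063222740399524504
  19785 (n (n (n (n (n o 11063222740399533241 10347 o) 11063222740434126456 20811 o)
  11063222740434135721 7306 (n o 11063222741006705751 11466 o)) 11063222741006706279 8326 (n (n o
  11063222744694360729 20779 o) 11063222744694369466 11434 (n o 11063222744729028215 21833 o)))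
  11063222744729037481 6246 (n (n (n (n o 11063222745301607510 12427 o) 11063222745301608039 7338
  o) 11063225012402489481 21802 (n o 11063225012402498746 8272 o)) 11063225012402555015 22835 (n
  (n o 11063225012402564281 7274 o) 11063225013009736790 9354 (n o 11063225013009736791 8304
  o)))))) 11063241504538995897 15656 (n (n (n (n (n (n (n o 11063241504538995898 14596 o)
  11063241505146168407 16676 o) 11063241505146177673 1026 (n o 11063241505146233942 15688 o))
  11063241505146243207 2052 (n (n o 11063243772247124649 16687 o) 11063243772247125178 11463 (n o
  11063243772819695207 17678 o))) 11063243772819704473 2085 (n (n (n (n o 11063243772854363222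
  12495 o) 11063243772854371959 3143 o) 11063243776542026409 15598 (n o 11063243776542026937 12463
  o)) 11063243777114596967 16655 (n (n o 11063243777114606232 3111 o) 11063243777149199447 13543
  (n o 11063243777149208184 4165 o)))) 11063262536959166601 12518 (n (n (n (n (n o
  11063262536959167129 9450 o) 11063262536959232135 13545 o) 11063262536959232664 8331 (n o
  11063262536993834615 10411 o)) 11063262536993834616 9418 (n (n o 11067707580181219992 15624 o)
  11067707580181220009 12516 (n o 11067707580215821944 16655 o))) 11067707580215822489 9383 (n (n
  (n (n o 11067707580216936039 13518 o) 11067707580216936567 10383 o) 11067726271308466840 18699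
  (n o 11067726271308475561 11402 o)) 11067726271343068792 19722 (n (n o 11067726271343078041 8240
  o) 11067726271914599527 12486 (n o 11067726271914600055 9418 o))))) 11067726344320682665 19785
  (n (n (n (n (n (n o 11067726344320691386 12427 o) 11067726344356398695 20755 o)
  11067726344356407961 5194 (n o 11067726344927929430 13513 o)) 11067726344927929975 6251 (n (n o
  11067728612028811417 20779 o) 11067728612028820666 9386 (n o 11067728612029925495 21801 o)))
  11067728612029934761 6246 (n (n (n (n o 11067728612636058710 10379 o) 11067728612636058727 7338
  o) 11067745035447938217 16719 (n o 11067745035447938234 13543 o)) 11067745036054062183 17646 (n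
  (n o 11067745036054071449 2053 o) 11067745036055176278 14575 (n o 11067745036055185527 3111
  o)))) 11067747303156066969 17735 (n (n (n (n (n o 11067747303156067514 10469 o)
  11067747303727588983 18756 o) 11067747303727598249 3106 (n o 11067747303763305558 11527 o))
  11067747303763314279 4197 (n (n o 11067747376169396889 14639 o) 11067747376169397417 11438 (n o
  11067747376740918903 15656 o))) 11067747376740928152 4132 (n (n (n (n o 11067747376775521383
  12463 o) 11067747376775530104 5191 o) 11067766067867060377 13546 (n o 11067766067867060905 10406
  o)) 11067766067868174455 14507 (n (n o 11067766067868175000 7370 o) 11067766067902776935 11434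
  (n o 11067766067902776952 8336 o)))))))) 11067989055157865113 14575 (n (n (n (n (n (n (n (n (n o
  11067989055157865129 13486 o) 11067989055192532599 15592 o) 11067989055192533144 8303 (n o
  11067989055193581159 14596 o)) 11067989055193581688 9415 (n (n o 11068007746285111961 17706 o)
  11068007746285120681 12454 (n o 11068007746319779447 18667 o))) 11068007746319788696 7338 (n (n
  (n (n o 11068007746891244647 13482 o) 11068007746891245176 8272 o) 11068007815002491561 18675 (n
  o 11068007815002500281 13481 o)) 11068007815038207591 19753 (n (n o 11068007815038216856 6219 o)
  11068007815609672791 14507 (n o 11068007815609673336 7274 o)))) 11068010087005522072 19721 (n (n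
  (n (n (n o 11068010087005531321 8299 o) 11068010087006570616 20747 o) 11068010087006579881 7306
  (n o 11068010087612703831 9418 o)) 11068010087612703847 8326 (n (n o 11068026506129747113 15566
  o) 11068026506129747129 14543 (n o 11068026506735871079 16687 o))) 11068026506735880344 3079 (n
  (n (n (n o 11068026506736919639 15623 o) 11068026506736928888 4133 o) 11068028778132777624 16676
  (n o 11068028778132778169 9447 o)) 11068028778704234104 17703 (n (n o 11068028778704243369 4165
  o) 11068028778739950679 10501 (n o 11068028778739959399 5186 o))))) 11068028846851205784 15624
  (n (n (n (n (n (n o 11068028846851206313 10383 o) 11068028847422662264 16655 o)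
  11068028847422671513 5159 (n o 11068028847457330279 11470 o)) 11068028847457338999 6212 (n (n o
  11068047538548869272 14539 o) 11068047538548869801 9354 (n o 11068047538549917816 15562 o)))
  11068047538549918361 8304 (n (n (n (n o 11068047538584585831 10406 o) 11068047538584585847 9450
  o) 11139765174219147416 16596 (n o 11139765174219147945 11469 o)) 11139765174220195960 17645 (n
  (n o 11139765174220196505 10403 o) 11139765174254863975 12373 (n o 11139765174254863991 11437
  o)))) 11139782765868320920 17736 (n (n (n (n (n o 11139782765868329641 10383 o)
  11139782765869369464 18767 o) 11139782765869378201 9319 (n o 11139782766440900199 11470 o))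
  11139782766440900215 10372 (n (n o 11139785037836683945 18799 o) 11139785037836692666 11399 (n o
  11139785037872399975 19790 o))) 11139785037872409241 4197 (n (n (n (n o 11139785038443930710
  12495 o) 11139785038443931255 5255 o) 11139785106555112089 19784 (n o 11139785106555120826 10351
  o)) 11139785106589779575 20694 (n (n o 11139785106589788841 5166 o) 11139785107162358870 11400
  (n o 11139785107162359399 6223 o)))))) 11139802629485865641 17677 (n (n (n (n (n (n (n o
  11139802629485866170 12483 o) 11139802630058436199 18668 o) 11139802630058445465 3169 (n o
  11139802630093104214 13581 o)) 11139802630093112951 4163 (n (n o 11139802698204293785 18676 o)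
  11139802698204294330 11437 (n o 11139802698775815799 19634 o))) 11139802698775825065 4108 (n (n
  (n (n o 11139802698811532374 12436 o) 11139802698811541095 5165 o) 11139804970207324825 13517 (n
  o 11139804970207324841 12405 o)) 11139804970778846839 14516 (n (n o 11139804970778855576 5197 o)
  11139804970779895399 13549 (n o 11139804970779904120 6243 o)))) 11139822562393361049 12452 (n (n
  (n (n (n o 11139822562393361065 11502 o) 11139822562428028535 13480 o) 11139822562428029080 6255
  (n o 11139822562429077095 12527 o)) 11139822562429077624 7335 (n (n o 11140046649195792537 15565
  o) 11140046649195793065 12341 (n o 11140046649196906615 16564 o))) 11140046649196907160 9357 (n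
  (n (n (n o 11140046649231509095 13549 o) 11140046649231509112 10403 o) 11140064240844966041
  16687 (n o 11140064240844974761 11438 o)) 11140064240846080119 17736 (n (n o
  11140064240846088856 8292 o) 11140064241417545319 12463 (n o 11140064241417545336 9351 o)))))
  11140066508518492841 17710 (n (n (n (n (n (n o 11140066508518501561 12463 o)
  11140066508554208871 18767 o) 11140066508554218136 5223 (n o 11140066509125674071 13479 o))
  11140066509125674616 6277 (n (n o 11140066581531822744 18614 o) 11140066581531831481 9320 (n o
  11140066581566424696 19752 o))) 11140066581566433961 6191 (n (n (n (n o 11140066582139003991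
  10383 o) 11140066582139004519 7246 o) 11140084100167674537 16588 (n o 11140084100167675065 13549
  o)) 11140084100740245095 17709 (n (n o 11140084100740254360 4131 o) 11140084100774847575 14563
  (n o 11140084100774856312 5185 o)))) 11140084173181004440 17554 (n (n (n (n (n o
  11140084173181004985 10356 o) 11140084173752460920 18676 o) 11140084173752470185 5133 (n o
  11140084173788177495 11469 o)) 11140084173788186215 6188 (n (n o 11140086440889133720 14516 o)
  11140086440889133737 11469 (n o 11140086441460590200 15597 o))) 11140086441460598937 6243 (n (n
  (n (n o 11140086441461704295 12437 o) 11140086441461713015 7277 o) 11140104033075169944 13512 (n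
  o 11140104033075169961 10447 o)) 11140104033109771896 14532 (n (n o 11140104033109772441 7367 o)
  11140104033110885991 11470 (n o 11140104033110886519 8335 o))))))) 11144550248823163017 14508 (n
  (n (n (n (n (n (n (n o 11144550248823163545 11469 o) 11144550248823228551 15474 o)
  11144550248823229080 10356 (n o 11144550248857831031 12436 o)) 11144550248857831032 11437 (n (n
  o 11144567840472336521 15694 o) 11144567840472345241 10447 (n o 11144567840472402055 16534 o)))
  11144567840472410776 9352 (n (n (n (n o 11144567841043867255 11432 o) 11144567841043867256 10415
  o) 11144570108145863321 16655 (n o 11144570108145872041 11406 o)) 11144570108180530807 17672 (n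
  (n o 11144570108180540056 6223 o) 11144570108751996007 12452 (n o 11144570108751996536 7335
  o)))) 11144570112440765080 17704 (n (n (n (n (n o 11144570112440773801 10372 o)
  11144570112475367032 18735 o) 11144570112475376281 7303 (n o 11144570113046897767 11438 o))
  11144570113046898295 8303 (n (n o 11144587699795045017 15597 o) 11144587699795045545 12373 (n o
  11144587700366567031 16596 o))) 11144587700366576280 5165 (n (n (n (n o 11144587700401169511
  13517 o) 11144587700401178232 6243 o) 11144587704089946776 16596 (n o 11144587704089947305 11437
  o)) 11144587704661403256 17677 (n (n o 11144587704661412505 6211 o) 11144587704696071271 12405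
  (n o 11144587704696079991 7245 o))))) 11144589971798076056 13581 (n (n (n (n (n (n o
  11144589971798076057 12483 o) 11144589972369532536 14563 o) 11144589972369541257 7265 (n o
  11144589972369598071 13549 o)) 11144589972369606791 8268 (n (n o 11144607563984112280 12495 o)
  11144607563984112281 11431 (n o 11144607564018714232 13511 o))) 11144607564018714761 8357 (n (n
  (n (n o 11144607564018779767 12463 o) 11144607564018780295 9326 o) 11216607842861090953 13550 (n
  o 11216607842861090969 12527 o)) 11216607842861156487 14454 (n (n o 11216607842861156504 11432
  o) 11216607842862205047 13512 (n o 11216607842862205048 12495 o)))) 11216626533988337801 14630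
  (n (n (n (n (n o 11216626533988346521 9514 o) 11216626533988403335 15657 o) 11216626533988412056
  8331 (n o 11216626534559868535 10411 o)) 11216626534559868536 9482 (n (n o 11216626602705717401
  15689 o) 11216626602705726121 10355 (n o 11216626602706831479 16503 o))) 11216626602706840216
  7273 (n (n (n (n o 11216626603278296679 11433 o) 11216626603278296696 8331 o)
  11216626607000619160 16471 (n o 11216626607000627881 9353 o)) 11216626607001667704 17737 (n (n o
  11216626607001676441 8299 o) 11216626607573198439 10355 (n o 11216626607573198455 9353 o))))))
  11216645293832972953 14607 (n (n (n (n (n (n (n o 11216645293832972969 13518 o)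
  11216645294404494967 15624 o) 11216645294404503704 6212 (n o 11216645294405543527 14543 o))
  11216645294405552248 7271 (n (n o 11216645298127874712 15592 o) 11216645298127874729 12463 (n o
  11216645298699331192 16623 o))) 11216645298699339929 7239 (n (n (n (n o 11216645298700445287
  13550 o) 11216645298700454007 8292 o) 11216645366846302872 14486 (n o 11216645366846302873 13512
  o)) 11216645367417759352 15592 (n (n o 11216645367417768073 8292 o) 11216645367417824887 14518
  (n o 11216645367417833607 9233 o)))) 11216664058543966360 11465 (n (n (n (n (n o
  11216664058543966361 10411 o) 11216664058545014904 12491 o) 11216664058545014921 9514 (n o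
  11216664058545080439 11433 o)) 11216664058545080455 10323 (n (n o 12369546939117111433 12518 o)
  12369546939117111449 11498 (n o 12369546939117176967 13577 o))) 12369546939117176984 10411 (n (n
  (n (n o 12369546939118225527 12491 o) 12369546939118225528 11466 o) 12369548038595184777 13506
  (n o 12369548038595185305 10501 o)) 12369548038595250311 14596 (n (n o 12369548038595250840 9479
  o) 12369548038629852791 11527 (n o 12369548038629852792 10469 o))))) 12369548107312564377 14532
  (n (n (n (n (n (n o 12369548107312564905 11470 o) 12369548107313678455 15560 o)
  12369548107313679000 8335 (n o 12369548107348280935 12495 o)) 12369548107348280952 9415 (n (n o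
  12369548111607466136 15592 o) 12369548111607466665 10415 (n o 12369548111608514680 16612 o)))
  12369548111608515225 9447 (n (n (n (n o 12369548111643182695 11438 o) 12369548111643182711 10415
  o) 12369549206790638233 13578 (n o 12369549206790638249 12486 o)) 12369549206825305719 14539 (n
  (n o 12369549206825306264 7402 o) 12369549206826354279 13514 (n o 12369549206826354808 8304
  o)))) 12369549211085539992 14571 (n (n (n (n (n o 12369549211085540009 11434 o)
  12369549211120141944 15594 o) 12369549211120142489 8272 (n o 12369549211121256039 12486 o))
  12369549211121256567 9482 (n (n o 12369549279803968152 13545 o) 12369549279803968153 12491 (n o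
  12369549279838570104 14571 o))) 12369549279838570633 9482 (n (n (n (n o 12369549279838635639
  13513 o) 12369549279838636167 10291 o) 12369550379315595416 12527 (n o 12369550379315595417
  11463 o)) 12369550379316643960 13543 (n (n o 12369550379316643977 10437 o) 12369550379316709495
  12495 (n o 12369550379316709511 11406 o)))))))))

/-- Codes of class representatives. -/
def f4Reps : List ℕ :=
  [10991186110097950857, 10991186110098016391, 11063241505146177673, 10991186183110232216,
  11063241505146243207, 11067745036054071449, 8613301999554300041, 11068026506735880344,
  8685360766082582680, 8613301999554365575, 8608798399926929561, 8608516924950284440,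
  11139802698775825065, 11140084173752470185, 8536741974084455081, 8536460503402646185,
  9761683548173601433, 11216645367417833607, 8685340901858913465, 8459900477968517255,
  8685340901858847930, 8536440570495150761, 8608498233216904377, 8608760944054078104,
  8685340901858904199]

/-- Orders of the class representatives. -/
def f4Ords : List ℕ :=
  [1, 2, 2, 3, 2, 4, 3, 6, 6, 6, 6, 12, 2, 4, 4, 8, 6, 2, 2, 6, 6, 4, 4, 3, 2]

/-- In-order list of the entries. -/
def F4Tree.toL : F4Tree → List (ℕ × ℕ) → List (ℕ × ℕ)
  | .o, acc => acc
  | .n l k v r, acc => l.toL ((k, v) :: r.toL acc)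

/-- Look up a key; the result is `0` or the value plus one. -/
def F4Tree.find (x : ℕ) : F4Tree → ℕ
  | .o => 0
  | .n l k v r => cond (Nat.beq x k) (v + 1) (cond (Nat.blt x k) (l.find x) (r.find x))

/-- Evaluate a number before using it. -/
def f4force {α : Type} (x : ℕ) (f : ℕ → α) : α :=
  Nat.rec (f 0) (fun m _ => f (m + 1)) x

theorem f4force_eq {α : Type} (x : ℕ) (f : ℕ → α) : f4force x f = f x := by
  cases x <;> rfl

def f4look (t : F4T) : ℕ :=
  cond (f4rng t) (f4force (f4enc t) fun x => f4Tree.find x) 0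

/-- Value layout: label, distance to the class representative, length. -/
def f4lab (v : ℕ) : ℕ := v % 32
def f4dep (v : ℕ) : ℕ := v / 32 % 32
def f4len (v : ℕ) : ℕ := v / 1024

/-- Values are shifted by one in the checks: `w = v + 1` and `w = 0` means failure. -/
def f4ck4 (w1 w2 w3 w4 : ℕ) (P : ℕ → Bool) : Bool :=
  Nat.blt 0 w1 && (Nat.blt 0 w2 && (Nat.blt 0 w3 && (Nat.blt 0 w4 &&
    (P (w1 - 1) && (P (w2 - 1) && (P (w3 - 1) && P (w4 - 1)))))))

def f4any4 (w1 w2 w3 w4 : ℕ) (P : ℕ → Bool) : Bool :=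
  P (w1 - 1) || (P (w2 - 1) || (P (w3 - 1) || P (w4 - 1)))

def f4okL (k v : ℕ) : Bool :=
  f4force (f4look (f4dec k).l1) fun w1 =>
  f4force (f4look (f4dec k).l2) fun w2 =>
  f4force (f4look (f4dec k).l3) fun w3 =>
  f4force (f4look (f4dec k).l4) fun w4 =>
    f4ck4 w1 w2 w3 w4 (fun _ => true) &&
    (Nat.beq k 10991186110097950857 ||
      f4any4 w1 w2 w3 w4 (fun w => Nat.blt (f4len w) (f4len v)))

def f4okC (k v : ℕ) : Bool :=
  f4force (f4look (f4dec k).l1.r1) fun w1 =>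
  f4force (f4look (f4dec k).l2.r2) fun w2 =>
  f4force (f4look (f4dec k).l3.r3) fun w3 =>
  f4force (f4look (f4dec k).l4.r4) fun w4 =>
    f4ck4 w1 w2 w3 w4 (fun w => Nat.beq (f4lab w) (f4lab v)) &&
    (Nat.beq k (f4Reps.getD (f4lab v) 0) ||
      f4any4 w1 w2 w3 w4 (fun w => Nat.blt (f4dep w) (f4dep v)))

def f4ok (k v : ℕ) : Bool :=
  Nat.blt k 18446744073709551616 && (Nat.blt (f4lab v) 25 && (f4okL k v && f4okC k v))

def F4Tree.all : F4Tree → Bool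
  | .o => true
  | .n l k v r => l.all && (f4ok k v && r.all)

def f4sorted : ℕ → List (ℕ × ℕ) → Bool
  | _, [] => true
  | x, (k, _) :: l => Nat.blt x k && f4sorted k l

theorem f4_all : f4Tree.all = true := by decide +kernel

theorem f4_sorted : f4sorted 0 (f4Tree.toL []) = true := by decide +kernel

/-- Multiply the code `c` by `r` until the identity is reached for the first time. -/
def f4ord (r : F4T) : ℕ → ℕ → Bool
  | 0, c => Nat.beq c 10991186110097950857
  | m + 1, c => !(Nat.beq c 10991186110097950857) &&
      (f4rng ((f4dec c).mul r) && f4force (f4enc ((f4dec c).mul r)) fun x => f4ord r m x)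

theorem f4_ord : (List.range 25).all (fun j =>
    f4ord (f4dec (f4Reps.getD j 0)) (f4Ords.getD j 0 - 1) (f4Reps.getD j 0) &&
    Nat.beq (f4lab (f4Tree.find (f4Reps.getD j 0) - 1)) j &&
    Nat.blt 0 (f4Tree.find (f4Reps.getD j 0)) && Nat.blt 0 (f4Ords.getD j 0)) = true := by
  decide +kernel

def f4cnt (n : ℕ) : ℕ :=
  ((f4Tree.toL []).filter fun p => Nat.beq (f4Ords.getD (f4lab p.2) 0) n).length

theorem f4_cnt : f4cnt 1 = 1 ∧ f4cnt 2 = 139 ∧ f4cnt 3 = 80 ∧ f4cnt 4 = 228 ∧ f4cnt 6 = 464 ∧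
    f4cnt 8 = 144 ∧ f4cnt 12 = 96 := by
  decide +kernel

/-! ### Soundness of the checks -/

def f4L : List (ℕ × ℕ) := f4Tree.toL []

theorem F4Tree.toL_eq (t : F4Tree) (acc : List (ℕ × ℕ)) : t.toL acc = t.toL [] ++ acc := by
  induction t generalizing acc with
  | o => rfl
  | n l k v r hl hr =>
    simp only [F4Tree.toL]
    rw [hl, hl ((k, v) :: r.toL []), hr acc]
    simp

theorem F4Tree.mem_of_find {x : ℕ} (t : F4Tree) (h : 0 < t.find x) :
    (x, t.find x - 1) ∈ t.toL [] := by
  induction t with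
  | o => simp [F4Tree.find] at h
  | n l k v r hl hr =>
    simp only [F4Tree.toL]
    rw [F4Tree.toL_eq]
    simp only [F4Tree.find] at h ⊢
    rcases h1 : Nat.beq x k with _ | _
    · simp only [h1, cond_false] at h ⊢
      rcases h2 : Nat.blt x k with _ | _
      · simp only [h2, cond_false] at h ⊢
        simp [hr h]
      · simp only [h2, cond_true] at h ⊢
        simp [hl h]
    · have : x = k := Nat.eq_of_beq_eq_true h1
      simp [this]

theorem F4Tree.ok_of_all (t : F4Tree) (h : t.all = true) :
    ∀ p ∈ t.toL [], f4ok p.1 p.2 = true := by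
  induction t with
  | o => simp [F4Tree.toL]
  | n l k v r hl hr =>
    simp only [F4Tree.all, Bool.and_eq_true] at h
    simp only [F4Tree.toL]
    rw [F4Tree.toL_eq]
    intro p hp
    simp only [List.mem_append, List.mem_cons] at hp
    rcases hp with hp | rfl | hp
    · exact hl h.1 p hp
    · exact h.2.1
    · exact hr h.2.2 p hp

theorem f4sorted_pairwise (l : List (ℕ × ℕ)) (x : ℕ) (h : f4sorted x l = true) :
    (x :: l.map Prod.fst).Pairwise (· < ·) := by
  induction l generalizing x with
  | nil => simp
  | cons p l ih =>
    obtain ⟨k, v⟩ := p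
    simp only [f4sorted, Bool.and_eq_true] at h
    have h1 : x < k := by simpa using h.1
    have h2 := ih k h.2
    rw [List.map_cons, List.pairwise_cons]
    refine ⟨?_, h2⟩
    intro y hy
    rcases List.mem_cons.1 hy with rfl | hy
    · exact h1
    · exact h1.trans ((List.pairwise_cons.1 h2).1 y hy)

theorem f4L_keys_nodup : (f4L.map Prod.fst).Nodup := by
  have := (List.pairwise_cons.1 (f4sorted_pairwise _ _ f4_sorted)).2
  exact this.imp fun h => h.ne

theorem f4L_val {k v v' : ℕ} (h : (k, v) ∈ f4L) (h₂ : (k, v') ∈ f4L) : v = v' := by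
  have := List.inj_on_of_nodup_map f4L_keys_nodup h h₂ rfl
  exact (Prod.mk.inj this).2

/-- `A` is the matrix of a table entry with value `v`. -/
def F4Q (A : Matrix (Fin 4) (Fin 4) ℚ) (v : ℕ) : Prop := ∃ k, (k, v) ∈ f4L ∧ (f4dec k).mat = A

theorem f4L_ok {k v : ℕ} (h : (k, v) ∈ f4L) : k < 18446744073709551616 ∧ f4lab v < 25 ∧
    f4okL k v = true ∧ f4okC k v = true := by
  have := F4Tree.ok_of_all _ f4_all _ h
  simpa [f4ok] using this

theorem f4key_inj {k v k₂ v' : ℕ} (h : (k, v) ∈ f4L) (h₂ : (k₂, v') ∈ f4L)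
    (hh : (f4dec k).mat = (f4dec k₂).mat) : k = k₂ ∧ v = v' := by
  have := f4dec_inj (f4L_ok h).1 (f4L_ok h₂).1 (F4T.mat_injective hh)
  subst this
  exact ⟨rfl, f4L_val h h₂⟩

theorem F4Q.unique {A : Matrix (Fin 4) (Fin 4) ℚ} {v v' : ℕ} (h : F4Q A v) (h₂ : F4Q A v') :
    v = v' := by
  obtain ⟨k, hk, rfl⟩ := h
  obtain ⟨k₂, hk', hh⟩ := h₂
  exact (f4key_inj hk hk' hh.symm).2

theorem f4look_Q {t : F4T} (h : 0 < f4look t) : F4Q t.mat (f4look t - 1) := by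
  unfold f4look at h ⊢
  rcases hr : f4rng t with _ | _
  · simp [hr] at h
  · simp only [hr, cond_true, f4force_eq] at h ⊢
    exact ⟨_, F4Tree.mem_of_find _ h, by rw [f4dec_enc t hr]⟩

/-- The generators as a family. -/
def f4S : Fin 4 → Matrix (Fin 4) (Fin 4) ℚ := ![s1, s2, s3, s4]

theorem f4S_sq (i : Fin 4) : f4S i * f4S i = 1 := by
  have h1 : F4T.one.l1.l1.mat = s1 * s1 := by
    rw [F4T.mat_l1, F4T.mat_l1, F4T.mat_one, mul_one]
  have h2 : F4T.one.l2.l2.mat = s2 * s2 := by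
    rw [F4T.mat_l2, F4T.mat_l2, F4T.mat_one, mul_one]
  have h3 : F4T.one.l3.l3.mat = s3 * s3 := by
    rw [F4T.mat_l3, F4T.mat_l3, F4T.mat_one, mul_one]
  have h4 : F4T.one.l4.l4.mat = s4 * s4 := by
    rw [F4T.mat_l4, F4T.mat_l4, F4T.mat_one, mul_one]
  fin_cases i
  · exact h1.symm.trans F4T.mat_one
  · exact h2.symm.trans F4T.mat_one
  · exact h3.symm.trans F4T.mat_one
  · exact h4.symm.trans F4T.mat_one

theorem f4dec_one : f4dec 10991186110097950857 = F4T.one := by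
  simp [f4dec, f4und, F4T.one]

theorem F4Q.left {A : Matrix (Fin 4) (Fin 4) ℚ} {v : ℕ} (h : F4Q A v) :
    (∀ i, ∃ w, F4Q (f4S i * A) w) ∧
    (A = 1 ∨ ∃ i w, F4Q (f4S i * A) w ∧ f4len w < f4len v) := by
  obtain ⟨k, hk, rfl⟩ := h
  have h := (f4L_ok hk).2.2.1
  simp only [f4okL, f4force_eq, f4ck4, f4any4, Bool.and_eq_true, Bool.or_eq_true,
    Nat.blt_eq, Nat.beq_eq] at h
  obtain ⟨⟨h1, h2, h3, h4, -⟩, h5⟩ := h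
  have q1 := f4look_Q h1
  have q2 := f4look_Q h2
  have q3 := f4look_Q h3
  have q4 := f4look_Q h4
  rw [F4T.mat_l1] at q1
  rw [F4T.mat_l2] at q2
  rw [F4T.mat_l3] at q3
  rw [F4T.mat_l4] at q4
  constructor
  · intro i
    fin_cases i
    · exact ⟨_, q1⟩
    · exact ⟨_, q2⟩
    · exact ⟨_, q3⟩
    · exact ⟨_, q4⟩
  · rcases h5 with h5 | h5 | h5 | h5 | h5
    · left
      rw [h5, f4dec_one, F4T.mat_one]
    · exact Or.inr ⟨0, _, q1, h5⟩
    · exact Or.inr ⟨1, _, q2, h5⟩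
    · exact Or.inr ⟨2, _, q3, h5⟩
    · exact Or.inr ⟨3, _, q4, h5⟩

/-- The matrix of the representative with label `j`. -/
def f4R (j : ℕ) : Matrix (Fin 4) (Fin 4) ℚ := (f4dec (f4Reps.getD j 0)).mat

theorem F4Q.conj {A : Matrix (Fin 4) (Fin 4) ℚ} {v : ℕ} (h : F4Q A v) :
    (∀ i, ∃ w, F4Q (f4S i * A * f4S i) w ∧ f4lab w = f4lab v) ∧
    (A = f4R (f4lab v) ∨
      ∃ i w, F4Q (f4S i * A * f4S i) w ∧ f4lab w = f4lab v ∧ f4dep w < f4dep v) := by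
  obtain ⟨k, hk, rfl⟩ := h
  have h := (f4L_ok hk).2.2.2
  simp only [f4okC, f4force_eq, f4ck4, f4any4, Bool.and_eq_true, Bool.or_eq_true,
    Nat.blt_eq, Nat.beq_eq] at h
  obtain ⟨⟨h1, h2, h3, h4, l1, l2, l3, l4⟩, h5⟩ := h
  have q1 := f4look_Q h1
  have q2 := f4look_Q h2
  have q3 := f4look_Q h3
  have q4 := f4look_Q h4
  rw [F4T.mat_r1, F4T.mat_l1] at q1
  rw [F4T.mat_r2, F4T.mat_l2] at q2
  rw [F4T.mat_r3, F4T.mat_l3] at q3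
  rw [F4T.mat_r4, F4T.mat_l4] at q4
  constructor
  · intro i
    fin_cases i
    · exact ⟨_, q1, l1⟩
    · exact ⟨_, q2, l2⟩
    · exact ⟨_, q3, l3⟩
    · exact ⟨_, q4, l4⟩
  · rcases h5 with h5 | h5 | h5 | h5 | h5
    · left
      rw [h5, f4R]
    · exact Or.inr ⟨0, _, q1, l1, h5⟩
    · exact Or.inr ⟨1, _, q2, l2, h5⟩
    · exact Or.inr ⟨2, _, q3, l3, h5⟩
    · exact Or.inr ⟨3, _, q4, l4, h5⟩

theorem f4_rep {j : ℕ} (hj : j < 25) :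
    f4ord (f4dec (f4Reps.getD j 0)) (f4Ords.getD j 0 - 1) (f4Reps.getD j 0) = true ∧
    (∃ v, F4Q (f4R j) v ∧ f4lab v = j) ∧ 0 < f4Ords.getD j 0 := by
  have := List.all_eq_true.1 f4_ord j (List.mem_range.2 hj)
  simp only [Bool.and_eq_true, Nat.blt_eq, Nat.beq_eq] at this
  obtain ⟨⟨⟨h1, h2⟩, h3⟩, h4⟩ := this
  exact ⟨h1, ⟨_, ⟨_, F4Tree.mem_of_find _ h3, rfl⟩, h2⟩, h4⟩

theorem f4R_zero : f4R 0 = 1 := by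
  rw [← F4T.mat_one, ← f4dec_one]
  rfl

theorem f4dec_mat_eq_one {c : ℕ} (hc : c < 18446744073709551616) (h : (f4dec c).mat = 1) :
    c = 10991186110097950857 := by
  rw [← F4T.mat_one, ← f4dec_one] at h
  exact f4dec_inj hc (by norm_num) (F4T.mat_injective h)

theorem f4enc_lt (t : F4T) (h : f4rng t = true) : f4enc t < 18446744073709551616 := by
  obtain ⟨a, b, c, d, e, f, g, h, i, j, k, l, m, n, o, p⟩ := t
  simp only [f4rng, f4small, Bool.and_eq_true, Nat.blt_eq] at h
  unfold f4enc
  dsimp only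
  omega

theorem f4ord_sound (r : F4T) (m c : ℕ) (hc : c < 18446744073709551616)
    (h : f4ord r m c = true) :
    (f4dec c).mat * r.mat ^ m = 1 ∧ ∀ q < m, (f4dec c).mat * r.mat ^ q ≠ 1 := by
  induction m generalizing c with
  | zero =>
    simp only [f4ord, Nat.beq_eq] at h
    simp [h, f4dec_one, F4T.mat_one]
  | succ m ih =>
    simp only [f4ord, f4force_eq, Bool.and_eq_true, Bool.not_eq_true'] at h
    obtain ⟨h1, h2, h3⟩ := h
    have h1' : c ≠ 10991186110097950857 := Nat.ne_of_beq_eq_false h1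
    have := ih _ (f4enc_lt _ h2) h3
    rw [f4dec_enc _ h2, F4T.mat_mul] at this
    refine ⟨by rw [pow_succ', ← mul_assoc]; exact this.1, ?_⟩
    intro q hq
    rcases q with _ | q
    · intro h0
      rw [pow_zero, mul_one] at h0
      exact h1' (f4dec_mat_eq_one hc h0)
    · rw [pow_succ', ← mul_assoc]
      exact this.2 q (by omega)

theorem f4R_order {j : ℕ} (hj : j < 25) : orderOf (f4R j) = f4Ords.getD j 0 := by
  obtain ⟨h1, ⟨v, hv, hl⟩, h3⟩ := f4_rep hj
  have hlt : f4Reps.getD j 0 < 18446744073709551616 := by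
    have := List.all_eq_true.1 f4_ord j (List.mem_range.2 hj)
    simp only [Bool.and_eq_true, Nat.blt_eq, Nat.beq_eq] at this
    exact (f4L_ok (F4Tree.mem_of_find _ this.1.2)).1
  obtain ⟨e1, e2⟩ := f4ord_sound _ _ _ hlt h1
  rw [orderOf_eq_iff h3]
  change f4R j * f4R j ^ _ = 1 at e1
  refine ⟨?_, ?_⟩
  · rw [← pow_succ', Nat.sub_add_cancel h3] at e1
    exact e1
  · intro m hm h0 he
    refine e2 (m - 1) (by omega) ?_
    change f4R j * f4R j ^ _ = 1
    rw [← pow_succ', Nat.sub_add_cancel h0]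
    exact he

/-! ### The group -/

def f4sig (i : Fin 4) : Matrix.GeneralLinearGroup (Fin 4) ℚ :=
  ⟨f4S i, f4S i, f4S_sq i, f4S_sq i⟩

theorem f4sig_mem (i : Fin 4) : f4sig i ∈ Wgrp := by
  apply Subgroup.subset_closure
  fin_cases i
  · exact Or.inl rfl
  · exact Or.inr (Or.inl rfl)
  · exact Or.inr (Or.inr (Or.inl rfl))
  · exact Or.inr (Or.inr (Or.inr rfl))

def f4tau (i : Fin 4) : ↥Wgrp := ⟨f4sig i, f4sig_mem i⟩

/-- The matrix of a group element. -/
def f4M (g : ↥Wgrp) : Matrix (Fin 4) (Fin 4) ℚ := ((g : Matrix.GeneralLinearGroup (Fin 4) ℚ) : _)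

theorem f4M_mul (g h : ↥Wgrp) : f4M (g * h) = f4M g * f4M h := rfl
theorem f4M_one : f4M 1 = 1 := rfl
theorem f4M_tau (i : Fin 4) : f4M (f4tau i) = f4S i := rfl
theorem f4M_inj {g h : ↥Wgrp} (e : f4M g = f4M h) : g = h := Subtype.ext (Units.ext e)

theorem f4tau_inv (i : Fin 4) : (f4tau i)⁻¹ = f4tau i := by
  rw [inv_eq_iff_mul_eq_one]
  apply f4M_inj
  rw [f4M_mul, f4M_tau, f4S_sq, f4M_one]

theorem f4_induction (p : ↥Wgrp → Prop) (h1 : p 1) (hm : ∀ i g, p g → p (f4tau i * g))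
    (g : ↥Wgrp) : p g := by
  have hset : ∀ x : Matrix.GeneralLinearGroup (Fin 4) ℚ,
      x ∈ {g : Matrix.GeneralLinearGroup (Fin 4) ℚ |
        (g : Matrix (Fin 4) (Fin 4) ℚ) = s1 ∨ (g : Matrix (Fin 4) (Fin 4) ℚ) = s2 ∨
        (g : Matrix (Fin 4) (Fin 4) ℚ) = s3 ∨ (g : Matrix (Fin 4) (Fin 4) ℚ) = s4} →
      ∃ i, x = f4sig i := by
    rintro x (h | h | h | h)
    · exact ⟨0, Units.ext h⟩
    · exact ⟨1, Units.ext h⟩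
    · exact ⟨2, Units.ext h⟩
    · exact ⟨3, Units.ext h⟩
  obtain ⟨g, hg⟩ := g
  refine Subgroup.closure_induction_left (p := fun x hx => p ⟨x, hx⟩) h1 ?_ ?_ hg
  · intro x hx y hy hp
    obtain ⟨i, rfl⟩ := hset x hx
    exact hm i ⟨y, hy⟩ hp
  · intro x hx y hy hp
    obtain ⟨i, rfl⟩ := hset x hx
    have := hm i ⟨y, hy⟩ hp
    rw [← f4tau_inv] at this
    exact this

theorem f4_exists_val (g : ↥Wgrp) : ∃ v, F4Q (f4M g) v := by
  induction g using f4_induction with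
  | h1 =>
    obtain ⟨v, hv, -⟩ := (f4_rep (j := 0) (by norm_num)).2.1
    rw [f4R_zero] at hv
    exact ⟨v, hv⟩
  | hm i g ih =>
    obtain ⟨v, hv⟩ := ih
    exact hv.left.1 i

/-- The table value of a group element. -/
def f4val (g : ↥Wgrp) : ℕ := (f4_exists_val g).choose

theorem f4val_spec (g : ↥Wgrp) : F4Q (f4M g) (f4val g) := (f4_exists_val g).choose_spec

theorem f4val_eq {g : ↥Wgrp} {v : ℕ} (h : F4Q (f4M g) v) : f4val g = v :=
  (f4val_spec g).unique h

theorem f4_surj {A : Matrix (Fin 4) (Fin 4) ℚ} {v : ℕ} (h : F4Q A v) : ∃ g, f4M g = A := by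
  induction hn : f4len v using Nat.strong_induction_on generalizing A v with
  | _ n ih =>
    rcases h.left.2 with rfl | ⟨i, w, hw, hlt⟩
    · exact ⟨1, f4M_one⟩
    · obtain ⟨g, hg⟩ := ih _ (hn ▸ hlt) hw rfl
      refine ⟨f4tau i * g, ?_⟩
      rw [f4M_mul, hg, f4M_tau, ← mul_assoc, f4S_sq, one_mul]

theorem f4lab_lt (g : ↥Wgrp) : f4lab (f4val g) < 25 := by
  obtain ⟨k, hk, -⟩ := f4val_spec g
  exact (f4L_ok hk).2.1

theorem f4lab_conj (h g : ↥Wgrp) : f4lab (f4val (h * g * h⁻¹)) = f4lab (f4val g) := by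
  induction h using f4_induction with
  | h1 => simp
  | hm i h ih =>
    rw [← ih]
    obtain ⟨w, hw, hl⟩ := (f4val_spec (h * g * h⁻¹)).conj.1 i
    rw [← hl]
    have e : f4S i * f4M (h * g * h⁻¹) * f4S i = f4M (f4tau i * h * g * (f4tau i * h)⁻¹) := by
      rw [← f4M_tau, ← f4M_mul, ← f4M_mul, mul_inv_rev, f4tau_inv]
      simp only [mul_assoc]
    rw [e] at hw
    rw [f4val_eq hw]

theorem f4_isConj_rep (g r : ↥Wgrp) (hr : f4M r = f4R (f4lab (f4val g))) : IsConj g r := by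
  induction hn : f4dep (f4val g) using Nat.strong_induction_on generalizing g with
  | _ n ih =>
    rcases (f4val_spec g).conj.2 with h | ⟨i, w, hw, hl, hlt⟩
    · rw [f4M_inj (h.trans hr.symm)]
    · rw [← f4M_tau, ← f4M_mul, ← f4M_mul] at hw
      have e := f4val_eq hw
      have h1 := ih _ (by rw [← hn]; exact hlt) (f4tau i * g * f4tau i)
        (by rw [e, hl]; exact hr) (by rw [e])
      refine IsConj.trans ?_ h1
      rw [isConj_iff]
      exact ⟨f4tau i, by rw [f4tau_inv]⟩

theorem f4_exists_rep {j : ℕ} (hj : j < 25) : ∃ r : ↥Wgrp, f4M r = f4R j ∧ f4lab (f4val r) = j := by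
  obtain ⟨v, hv, hl⟩ := (f4_rep hj).2.1
  obtain ⟨r, hr⟩ := f4_surj hv
  refine ⟨r, hr, ?_⟩
  rw [← hr] at hv
  rw [f4val_eq hv, hl]

theorem f4_isConj_iff (g h : ↥Wgrp) : IsConj g h ↔ f4lab (f4val g) = f4lab (f4val h) := by
  constructor
  · rw [isConj_iff]
    rintro ⟨c, rfl⟩
    exact (f4lab_conj c g).symm
  · intro e
    obtain ⟨r, hr, -⟩ := f4_exists_rep (f4lab_lt g)
    exact (f4_isConj_rep g r hr).trans (f4_isConj_rep h r (by rw [← e, hr])).symm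

theorem f4_orderOf (g : ↥Wgrp) : orderOf g = f4Ords.getD (f4lab (f4val g)) 0 := by
  obtain ⟨r, hr, -⟩ := f4_exists_rep (f4lab_lt g)
  have hc := f4_isConj_rep g r hr
  rw [isConj_iff] at hc
  obtain ⟨c, rfl⟩ := hc
  rw [← f4R_order (f4lab_lt g), ← hr]
  have h1 : orderOf (f4M (c * g * c⁻¹)) = orderOf (c * g * c⁻¹) := by
    let φ : ↥Wgrp →* Matrix (Fin 4) (Fin 4) ℚ :=
      { toFun := f4M, map_one' := f4M_one, map_mul' := f4M_mul }
    exact orderOf_injective φ (fun _ _ e => f4M_inj e) (c * g * c⁻¹)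
  rw [h1]
  exact ((MulAut.conj c).orderOf_eq g).symm

/-- The label of a conjugacy class. -/
def f4cls : ConjClasses ↥Wgrp ≃ Fin 25 :=
  Equiv.ofBijective
    (fun c => Quotient.lift (s := IsConj.setoid ↥Wgrp)
      (fun g => (⟨f4lab (f4val g), f4lab_lt g⟩ : Fin 25))
      (fun g h e => Fin.ext ((f4_isConj_iff g h).1 e)) c) (by
    constructor
    · intro c d
      obtain ⟨g, rfl⟩ := ConjClasses.exists_rep c
      obtain ⟨g₂, rfl⟩ := ConjClasses.exists_rep d
      intro e
      exact ConjClasses.mk_eq_mk_iff_isConj.2 ((f4_isConj_iff g g₂).2 (Fin.ext_iff.1 e))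
    · intro j
      obtain ⟨r, -, hr⟩ := f4_exists_rep j.2
      exact ⟨ConjClasses.mk r, Fin.ext hr⟩)

theorem f4cls_mk (g : ↥Wgrp) : (f4cls (ConjClasses.mk g) : ℕ) = f4lab (f4val g) := rfl

theorem f4_card_cls (n : ℕ) :
    Nat.card {c : ConjClasses ↥Wgrp // ∃ g : ↥Wgrp, ConjClasses.mk g = c ∧ orderOf g = n} =
    Fintype.card {j : Fin 25 // f4Ords.getD j 0 = n} := by
  rw [← Nat.card_eq_fintype_card]
  refine Nat.card_congr (f4cls.subtypeEquiv ?_)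
  intro c
  constructor
  · rintro ⟨g, rfl, h⟩
    rw [f4cls_mk, ← f4_orderOf, h]
  · intro h
    obtain ⟨g, rfl⟩ := ConjClasses.exists_rep c
    rw [f4cls_mk, ← f4_orderOf] at h
    exact ⟨g, rfl, h⟩

theorem f4_card_order (n : ℕ) : Nat.card {g : ↥Wgrp // orderOf g = n} = f4cnt n := by
  classical
  set l := f4L.filter fun p => Nat.beq (f4Ords.getD (f4lab p.2) 0) n with hl
  have hnd : l.Nodup := (List.Nodup.of_map _ f4L_keys_nodup).filter _
  have hcard : Nat.card {p // p ∈ l} = f4cnt n := by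
    have h1 : Nat.card {p // p ∈ l.toFinset} = l.toFinset.card := by
      rw [Nat.card_eq_fintype_card, Fintype.card_coe]
    rw [List.toFinset_card_of_nodup hnd] at h1
    simp only [List.mem_toFinset] at h1
    exact h1
  rw [← hcard]
  symm
  have hmem : ∀ p : {p // p ∈ l}, (p.1.1, p.1.2) ∈ f4L ∧ f4Ords.getD (f4lab p.1.2) 0 = n := by
    rintro ⟨p, hp⟩
    rw [hl, List.mem_filter] at hp
    exact ⟨hp.1, by simpa using hp.2⟩
  have hex : ∀ p : {p // p ∈ l}, ∃ g : ↥Wgrp, f4M g = (f4dec p.1.1).mat := fun p =>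
    f4_surj ⟨_, (hmem p).1, rfl⟩
  choose G hG using hex
  have hGo : ∀ p, orderOf (G p) = n := by
    intro p
    rw [f4_orderOf, f4val_eq (v := p.1.2) ⟨p.1.1, (hmem p).1, (hG p).symm⟩]
    exact (hmem p).2
  refine Nat.card_congr (Equiv.ofBijective (fun p => ⟨G p, hGo p⟩) ⟨?_, ?_⟩)
  · intro p q e
    have e₂ : G p = G q := Subtype.ext_iff.1 e
    have := f4key_inj (hmem p).1 (hmem q).1 (by rw [← hG, ← hG, e₂])
    exact Subtype.ext (Prod.ext this.1 this.2)
  · rintro ⟨g, hg⟩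
    obtain ⟨k, hk, hkm⟩ := f4val_spec g
    have hp : (k, f4val g) ∈ l := by
      rw [hl, List.mem_filter]
      refine ⟨hk, ?_⟩
      rw [f4_orderOf] at hg
      simpa using hg
    refine ⟨⟨_, hp⟩, Subtype.ext (f4M_inj ?_)⟩
    exact (hG ⟨_, hp⟩).trans hkm

theorem f4_ords_mem : ∀ j : Fin 25, f4Ords.getD j 0 = 1 ∨ f4Ords.getD j 0 = 2 ∨
    f4Ords.getD j 0 = 3 ∨ f4Ords.getD j 0 = 4 ∨ f4Ords.getD j 0 = 6 ∨ f4Ords.getD j 0 = 8 ∨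
    f4Ords.getD j 0 = 12 := by
  decide +kernel

/-- the Weyl group `W` of `F₄` has exactly 25 conjugacy classes; its elements
have orders in `{1,2,3,4,6,8,12}`; the number of elements of each order is respectively
`1, 139, 80, 228, 464, 144, 96`, and the number of conjugacy classes consisting of elements
of each order is respectively `1, 7, 3, 5, 7, 1, 1`. -/
theorem weylF4_conjugacy_classes :
    Nat.card (ConjClasses ↥Wgrp) = 25 ∧
    (∀ g : ↥Wgrp, orderOf g ∈ ({1, 2, 3, 4, 6, 8, 12} : Set ℕ)) ∧
    (Nat.card {g : ↥Wgrp // orderOf g = 1} = 1 ∧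
     Nat.card {g : ↥Wgrp // orderOf g = 2} = 139 ∧
     Nat.card {g : ↥Wgrp // orderOf g = 3} = 80 ∧
     Nat.card {g : ↥Wgrp // orderOf g = 4} = 228 ∧
     Nat.card {g : ↥Wgrp // orderOf g = 6} = 464 ∧
     Nat.card {g : ↥Wgrp // orderOf g = 8} = 144 ∧
     Nat.card {g : ↥Wgrp // orderOf g = 12} = 96) ∧
    (Nat.card {c : ConjClasses ↥Wgrp // ∃ g : ↥Wgrp, ConjClasses.mk g = c ∧ orderOf g = 1} = 1 ∧
     Nat.card {c : ConjClasses ↥Wgrp // ∃ g : ↥Wgrp, ConjClasses.mk g = c ∧ orderOf g = 2} = 7 ∧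
     Nat.card {c : ConjClasses ↥Wgrp // ∃ g : ↥Wgrp, ConjClasses.mk g = c ∧ orderOf g = 3} = 3 ∧
     Nat.card {c : ConjClasses ↥Wgrp // ∃ g : ↥Wgrp, ConjClasses.mk g = c ∧ orderOf g = 4} = 5 ∧
     Nat.card {c : ConjClasses ↥Wgrp // ∃ g : ↥Wgrp, ConjClasses.mk g = c ∧ orderOf g = 6} = 7 ∧
     Nat.card {c : ConjClasses ↥Wgrp // ∃ g : ↥Wgrp, ConjClasses.mk g = c ∧ orderOf g = 8} = 1 ∧
     Nat.card {c : ConjClasses ↥Wgrp // ∃ g : ↥Wgrp, ConjClasses.mk g = c ∧ orderOf g = 12} = 1) := by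
  refine ⟨?_, ?_, ?_, ?_⟩
  · rw [Nat.card_congr f4cls]
    simp
  · intro g
    rw [f4_orderOf]
    exact f4_ords_mem ⟨_, f4lab_lt g⟩
  · simp only [f4_card_order]
    exact f4_cnt
  · simp only [f4_card_cls]
    decide +kernel

end
end

section
/- The bracket defined on L = sl(X₁)⊕sl(X₂)⊕sl(X₃) ⊕ (X₁⊗X₂⊗X₃) ⊕ (X₁*⊗X₂*⊗X₃*) by the formulas in the context is skew-symmetric and satisfies the Jacobi identity, so that L is a Lie algebra over F; its dimension is 78 (L is a model of the exceptional simple Lie algebra e₆). -/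
noncomputable section

open Matrix
open scoped BigOperators

variable (F : Type*) [Field F] [IsAlgClosed F] [CharZero F]

set_option linter.unusedSectionVars false

/-- `gl₃ = M₃(F)`, the matrix algebra of a 3-dimensional space in a fixed basis. -/
abbrev gl3 := Matrix (Fin 3) (Fin 3) F

/-- Coordinates of a tensor in `X₁ ⊗ X₂ ⊗ X₃` with respect to the fixed bases. -/
abbrev T3 := Fin 3 → Fin 3 → Fin 3 → F

/-- The ambient space `(gl₃)³ × (X₁⊗X₂⊗X₃) × (X₁*⊗X₂*⊗X₃*)` containing the model of e₆. -/
abbrev Mbig := (gl3 F × gl3 F × gl3 F) × (T3 F × T3 F)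

/-- Trace-zero matrices: the coordinate model of `sl(X_i)`. -/
def sl3 : Submodule F (gl3 F) where
  carrier := {g | Matrix.trace g = 0}
  add_mem' := by intro a b ha hb; simp_all [Matrix.trace_add]
  zero_mem' := by simp
  smul_mem' := by intro c a ha; simp_all [Matrix.trace_smul]

lemma mem_sl3 {g : gl3 F} : g ∈ sl3 F ↔ Matrix.trace g = 0 := Iff.rfl

/-- The model of `e₆`: `sl(X₁)⊕sl(X₂)⊕sl(X₃) ⊕ X₁⊗X₂⊗X₃ ⊕ X₁*⊗X₂*⊗X₃*`, as a submodule
of the ambient space. -/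
def Lsub : Submodule F (Mbig F) :=
  ((sl3 F).prod ((sl3 F).prod (sl3 F))).prod
    ((⊤ : Submodule F (T3 F)).prod (⊤ : Submodule F (T3 F)))

/-- The fixed alternating trilinear form: determinant of the matrix with rows `x, y, z`. -/
def det3 (x y z : Fin 3 → F) : F := Matrix.det (Matrix.of ![x, y, z])

/-- The Levi-Civita symbol `ε_{abc} = det(e_a, e_b, e_c)`, encoding the identification
`X∧X ≅ X*` given by `x∧y ↦ det(x,y,−)` (and dually `X*∧X* ≅ X`). -/
def eps (a b c : Fin 3) : F :=
  det3 F (Pi.single a 1) (Pi.single b 1) (Pi.single c 1)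

/-- Coordinates of `[⊗x_i, ⊗y_i] = ⊗(x_i ∧ y_i)` (and of `[⊗f_i, ⊗g_i] = ⊗(f_i ∧ g_i)`). -/
def wedgeT (x y : T3 F) : T3 F := fun c d e =>
  ∑ i, ∑ j, ∑ k, ∑ l, ∑ m, ∑ n,
    x i j k * y l m n * eps F i l c * eps F j m d * eps F k n e

/-- Coordinates of the action of `(g₁,g₂,g₃) ∈ sl(X₁)⊕sl(X₂)⊕sl(X₃)` on `X₁⊗X₂⊗X₃`. -/
def actT (g : gl3 F × gl3 F × gl3 F) (x : T3 F) : T3 F := fun i j k =>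
  (∑ a, g.1 i a * x a j k) + (∑ a, g.2.1 j a * x i a k) + (∑ a, g.2.2 k a * x i j a)

/-- Coordinates of the action of `(g₁,g₂,g₃)` on `X₁*⊗X₂*⊗X₃*` (minus the dual action). -/
def coactT (g : gl3 F × gl3 F × gl3 F) (f : T3 F) : T3 F := fun i j k =>
  -((∑ a, g.1 a i * f a j k) + (∑ a, g.2.1 a j * f i a k) + (∑ a, g.2.2 a k * f i j a))

/-- The full contraction `⟨f, x⟩ = Σ f_{ijk} x_{ijk}`. -/
def tpair (f x : T3 F) : F := ∑ i, ∑ j, ∑ k, f i j k * x i j k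

/-- The `sl(X₁)`-component of `[⊗f_i, ⊗x_i]`. -/
def pair1 (f x : T3 F) : gl3 F := Matrix.of fun r s =>
  (∑ j, ∑ k, f s j k * x r j k) - (1/3 : F) * (if r = s then tpair F f x else 0)

/-- The `sl(X₂)`-component of `[⊗f_i, ⊗x_i]`. -/
def pair2 (f x : T3 F) : gl3 F := Matrix.of fun r s =>
  (∑ i, ∑ k, f i s k * x i r k) - (1/3 : F) * (if r = s then tpair F f x else 0)

/-- The `sl(X₃)`-component of `[⊗f_i, ⊗x_i]`. -/
def pair3 (f x : T3 F) : gl3 F := Matrix.of fun r s =>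
  (∑ i, ∑ j, f i j s * x i j r) - (1/3 : F) * (if r = s then tpair F f x else 0)

/-- The bracket of the model of `e₆`, written out on the ambient coordinate space. -/
def B (u v : Mbig F) : Mbig F :=
  ( ( (u.1.1 * v.1.1 - v.1.1 * u.1.1) + pair1 F u.2.2 v.2.1 - pair1 F v.2.2 u.2.1,
      (u.1.2.1 * v.1.2.1 - v.1.2.1 * u.1.2.1) + pair2 F u.2.2 v.2.1 - pair2 F v.2.2 u.2.1,
      (u.1.2.2 * v.1.2.2 - v.1.2.2 * u.1.2.2) + pair3 F u.2.2 v.2.1 - pair3 F v.2.2 u.2.1 ),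
    ( actT F u.1 v.2.1 - actT F v.1 u.2.1 + wedgeT F u.2.2 v.2.2,
      coactT F u.1 v.2.2 - coactT F v.1 u.2.2 + wedgeT F u.2.1 v.2.1 ) )

lemma trace_pair1 (f x : T3 F) : Matrix.trace (pair1 F f x) = 0 := by
  simp only [pair1, Matrix.trace, Matrix.diag, Matrix.of_apply, if_pos, tpair,
    Finset.sum_sub_distrib, Finset.sum_const, Finset.card_univ, Fintype.card_fin,
    nsmul_eq_mul, Nat.cast_ofNat]
  ring

lemma trace_pair2 (f x : T3 F) : Matrix.trace (pair2 F f x) = 0 := by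
  simp only [pair2, Matrix.trace, Matrix.diag, Matrix.of_apply, if_pos, tpair,
    Finset.sum_sub_distrib, Finset.sum_const, Finset.card_univ, Fintype.card_fin,
    nsmul_eq_mul, Nat.cast_ofNat]
  rw [Finset.sum_comm]
  ring

lemma sum_rotate (h : Fin 3 → Fin 3 → Fin 3 → F) :
    ∑ r, ∑ i, ∑ j, h i j r = ∑ i, ∑ j, ∑ r, h i j r := by
  rw [Finset.sum_comm]
  exact Finset.sum_congr rfl fun i _ => Finset.sum_comm

lemma trace_pair3 (f x : T3 F) : Matrix.trace (pair3 F f x) = 0 := by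
  simp only [pair3, Matrix.trace, Matrix.diag, Matrix.of_apply, if_pos, tpair,
    Finset.sum_sub_distrib, Finset.sum_const, Finset.card_univ, Fintype.card_fin,
    nsmul_eq_mul, Nat.cast_ofNat]
  rw [sum_rotate F (fun i j r => f i j r * x i j r)]
  ring

/-- The bracket takes values in (the ambient copy of) `L`. -/
lemma B_mem (u v : Mbig F) : B F u v ∈ Lsub F := by
  refine ⟨⟨?_, ?_, ?_⟩, trivial, trivial⟩
  · show Matrix.trace ((u.1.1 * v.1.1 - v.1.1 * u.1.1)
        + pair1 F u.2.2 v.2.1 - pair1 F v.2.2 u.2.1) = 0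
    rw [Matrix.trace_sub, Matrix.trace_add, Matrix.trace_sub, trace_pair1, trace_pair1,
      Matrix.trace_mul_comm]
    ring
  · show Matrix.trace ((u.1.2.1 * v.1.2.1 - v.1.2.1 * u.1.2.1)
        + pair2 F u.2.2 v.2.1 - pair2 F v.2.2 u.2.1) = 0
    rw [Matrix.trace_sub, Matrix.trace_add, Matrix.trace_sub, trace_pair2, trace_pair2,
      Matrix.trace_mul_comm]
    ring
  · show Matrix.trace ((u.1.2.2 * v.1.2.2 - v.1.2.2 * u.1.2.2)
        + pair3 F u.2.2 v.2.1 - pair3 F v.2.2 u.2.1) = 0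
    rw [Matrix.trace_sub, Matrix.trace_add, Matrix.trace_sub, trace_pair3, trace_pair3,
      Matrix.trace_mul_comm]
    ring

/-- The bracket of the model of `e₆` on `L` itself. -/
def Bsub (u v : ↥(Lsub F)) : ↥(Lsub F) := ⟨B F ↑u ↑v, B_mem F ↑u ↑v⟩


set_option linter.unusedSimpArgs false
set_option linter.unusedVariables false
set_option maxHeartbeats 4000000

lemma fin3_11 (c : Fin 3) : c + 1 + 1 = c + 2 := by revert c; decide
lemma fin3_12 (c : Fin 3) : c + 1 + 2 = c := by revert c; decide
lemma fin3_21 (c : Fin 3) : c + 2 + 1 = c := by revert c; decide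
lemma fin3_22 (c : Fin 3) : c + 2 + 2 = c + 1 := by revert c; decide
lemma fin3_ne1 (c : Fin 3) : (c = c + 1) = False := by revert c; decide
lemma fin3_ne2 (c : Fin 3) : (c = c + 2) = False := by revert c; decide
lemma fin3_ne3 (c : Fin 3) : (c + 1 = c) = False := by revert c; decide
lemma fin3_ne4 (c : Fin 3) : (c + 2 = c) = False := by revert c; decide
lemma fin3_ne5 (c : Fin 3) : (c + 1 = c + 2) = False := by revert c; decide
lemma fin3_ne6 (c : Fin 3) : (c + 2 = c + 1) = False := by revert c; decide

lemma fin3_cases (r s : Fin 3) : r = s ∨ s = r + 1 ∨ s = r + 2 := by revert r s; decide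

/-- A sum over `Fin 3`, starting cyclically at any chosen index. -/
lemma sum3 (c : Fin 3) (f : Fin 3 → F) : ∑ a, f a = f c + f (c + 1) + f (c + 2) := by
  rw [Fin.sum_univ_three]
  fin_cases c
  · rfl
  · show f 0 + f 1 + f 2 = f 1 + f 2 + f 0
    ring
  · show f 0 + f 1 + f 2 = f 2 + f 0 + f 1
    ring

/-- Contraction of a bilinear expression with the Levi-Civita symbol. -/
lemma sum_eps (h : Fin 3 → Fin 3 → F) (c : Fin 3) :
    ∑ i, ∑ l, h i l * eps F i l c = h (c + 1) (c + 2) - h (c + 2) (c + 1) := by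
  have e : ∀ i l : Fin 3, eps F i l c =
      if i = c + 1 ∧ l = c + 2 then 1 else if i = c + 2 ∧ l = c + 1 then -1 else 0 := by
    intro i l
    fin_cases c <;> fin_cases i <;> fin_cases l <;>
      simp [eps, det3, Matrix.det_fin_three]
  simp only [e, sum3 F c]
  simp
  ring

lemma wedgeT_apply (x y : T3 F) (c d e : Fin 3) : wedgeT F x y c d e =
    x (c+1) (d+1) (e+1) * y (c+2) (d+2) (e+2) - x (c+1) (d+1) (e+2) * y (c+2) (d+2) (e+1)
    - x (c+1) (d+2) (e+1) * y (c+2) (d+1) (e+2) + x (c+1) (d+2) (e+2) * y (c+2) (d+1) (e+1)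
    - x (c+2) (d+1) (e+1) * y (c+1) (d+2) (e+2) + x (c+2) (d+1) (e+2) * y (c+1) (d+2) (e+1)
    + x (c+2) (d+2) (e+1) * y (c+1) (d+1) (e+2) - x (c+2) (d+2) (e+2) * y (c+1) (d+1) (e+1) := by
  have h : wedgeT F x y c d e = ∑ i, ∑ l, (∑ j, ∑ m, (∑ k, ∑ n,
      (x i j k * y l m n) * eps F k n e) * eps F j m d) * eps F i l c := by
    simp only [wedgeT, Finset.sum_mul]
    refine Finset.sum_congr rfl fun i _ => ?_
    rw [Finset.sum_congr rfl fun j _ => Finset.sum_comm, Finset.sum_comm]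
    refine Finset.sum_congr rfl fun l _ => ?_
    refine Finset.sum_congr rfl fun j _ => ?_
    rw [Finset.sum_comm]
    refine Finset.sum_congr rfl fun m _ => ?_
    refine Finset.sum_congr rfl fun k _ => ?_
    refine Finset.sum_congr rfl fun n _ => ?_
    ring
  rw [h]
  simp only [sum_eps]
  ring

lemma actT_apply (g : gl3 F × gl3 F × gl3 F) (x : T3 F) (i j k : Fin 3) : actT F g x i j k =
    (g.1 i i * x i j k + g.1 i (i+1) * x (i+1) j k + g.1 i (i+2) * x (i+2) j k)
    + (g.2.1 j j * x i j k + g.2.1 j (j+1) * x i (j+1) k + g.2.1 j (j+2) * x i (j+2) k)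
    + (g.2.2 k k * x i j k + g.2.2 k (k+1) * x i j (k+1) + g.2.2 k (k+2) * x i j (k+2)) := by
  unfold actT
  rw [sum3 F i, sum3 F j, sum3 F k]

lemma coactT_apply (g : gl3 F × gl3 F × gl3 F) (x : T3 F) (i j k : Fin 3) : coactT F g x i j k =
    -((g.1 i i * x i j k + g.1 (i+1) i * x (i+1) j k + g.1 (i+2) i * x (i+2) j k)
    + (g.2.1 j j * x i j k + g.2.1 (j+1) j * x i (j+1) k + g.2.1 (j+2) j * x i (j+2) k)
    + (g.2.2 k k * x i j k + g.2.2 (k+1) k * x i j (k+1) + g.2.2 (k+2) k * x i j (k+2))) := by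
  unfold coactT
  rw [sum3 F i, sum3 F j, sum3 F k]

/-- Double sum over `Fin 3`, expanded cyclically from chosen base points. -/
lemma sum33 (j k : Fin 3) (h : Fin 3 → Fin 3 → F) : ∑ a, ∑ b, h a b =
    (h j k + h j (k+1) + h j (k+2)) + (h (j+1) k + h (j+1) (k+1) + h (j+1) (k+2))
    + (h (j+2) k + h (j+2) (k+1) + h (j+2) (k+2)) := by
  rw [sum3 F j, sum3 F k, sum3 F k, sum3 F k]

lemma tpair_apply (i : Fin 3) (f x : T3 F) : tpair F f x =
    (∑ a, ∑ b, f i a b * x i a b) + (∑ a, ∑ b, f (i+1) a b * x (i+1) a b)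
      + (∑ a, ∑ b, f (i+2) a b * x (i+2) a b) := by
  unfold tpair
  rw [sum3 F i]

lemma tpair_exp (i j k : Fin 3) (f x : T3 F) : tpair F f x =
    ((f i j k * x i j k + f i j (k+1) * x i j (k+1) + f i j (k+2) * x i j (k+2))
    + (f i (j+1) k * x i (j+1) k + f i (j+1) (k+1) * x i (j+1) (k+1)
      + f i (j+1) (k+2) * x i (j+1) (k+2))
    + (f i (j+2) k * x i (j+2) k + f i (j+2) (k+1) * x i (j+2) (k+1)
      + f i (j+2) (k+2) * x i (j+2) (k+2)))
    + ((f (i+1) j k * x (i+1) j k + f (i+1) j (k+1) * x (i+1) j (k+1)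
      + f (i+1) j (k+2) * x (i+1) j (k+2))
    + (f (i+1) (j+1) k * x (i+1) (j+1) k + f (i+1) (j+1) (k+1) * x (i+1) (j+1) (k+1)
      + f (i+1) (j+1) (k+2) * x (i+1) (j+1) (k+2))
    + (f (i+1) (j+2) k * x (i+1) (j+2) k + f (i+1) (j+2) (k+1) * x (i+1) (j+2) (k+1)
      + f (i+1) (j+2) (k+2) * x (i+1) (j+2) (k+2)))
    + ((f (i+2) j k * x (i+2) j k + f (i+2) j (k+1) * x (i+2) j (k+1)
      + f (i+2) j (k+2) * x (i+2) j (k+2))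
    + (f (i+2) (j+1) k * x (i+2) (j+1) k + f (i+2) (j+1) (k+1) * x (i+2) (j+1) (k+1)
      + f (i+2) (j+1) (k+2) * x (i+2) (j+1) (k+2))
    + (f (i+2) (j+2) k * x (i+2) (j+2) k + f (i+2) (j+2) (k+1) * x (i+2) (j+2) (k+1)
      + f (i+2) (j+2) (k+2) * x (i+2) (j+2) (k+2))) := by
  rw [tpair_apply F i, sum33 F j k, sum33 F j k, sum33 F j k]

lemma pair1_apply (j k : Fin 3) (f x : T3 F) (r s : Fin 3) : pair1 F f x r s =
    ((f s j k * x r j k + f s j (k+1) * x r j (k+1) + f s j (k+2) * x r j (k+2))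
    + (f s (j+1) k * x r (j+1) k + f s (j+1) (k+1) * x r (j+1) (k+1)
      + f s (j+1) (k+2) * x r (j+1) (k+2))
    + (f s (j+2) k * x r (j+2) k + f s (j+2) (k+1) * x r (j+2) (k+1)
      + f s (j+2) (k+2) * x r (j+2) (k+2)))
    - (1/3 : F) * (if r = s then tpair F f x else 0) := by
  rw [← sum33 F j k (fun j k => f s j k * x r j k)]
  rfl

lemma pair2_apply (j k : Fin 3) (f x : T3 F) (r s : Fin 3) : pair2 F f x r s =
    ((f j s k * x j r k + f j s (k+1) * x j r (k+1) + f j s (k+2) * x j r (k+2))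
    + (f (j+1) s k * x (j+1) r k + f (j+1) s (k+1) * x (j+1) r (k+1)
      + f (j+1) s (k+2) * x (j+1) r (k+2))
    + (f (j+2) s k * x (j+2) r k + f (j+2) s (k+1) * x (j+2) r (k+1)
      + f (j+2) s (k+2) * x (j+2) r (k+2)))
    - (1/3 : F) * (if r = s then tpair F f x else 0) := by
  rw [← sum33 F j k (fun j k => f j s k * x j r k)]
  rfl

lemma pair3_apply (j k : Fin 3) (f x : T3 F) (r s : Fin 3) : pair3 F f x r s =
    ((f j k s * x j k r + f j (k+1) s * x j (k+1) r + f j (k+2) s * x j (k+2) r)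
    + (f (j+1) k s * x (j+1) k r + f (j+1) (k+1) s * x (j+1) (k+1) r
      + f (j+1) (k+2) s * x (j+1) (k+2) r)
    + (f (j+2) k s * x (j+2) k r + f (j+2) (k+1) s * x (j+2) (k+1) r
      + f (j+2) (k+2) s * x (j+2) (k+2) r))
    - (1/3 : F) * (if r = s then tpair F f x else 0) := by
  rw [← sum33 F j k (fun j k => f j k s * x j k r)]
  rfl

lemma trace3 (c : Fin 3) (g : gl3 F) (h : Matrix.trace g = 0) :
    g c c + g (c+1) (c+1) + g (c+2) (c+2) = 0 := by
  rw [← h, Matrix.trace, sum3 F c]; rfl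

lemma mul3 (c : Fin 3) (g h : gl3 F) (r s : Fin 3) :
    (g * h) r s = g r c * h c s + g r (c+1) * h (c+1) s + g r (c+2) * h (c+2) s := by
  rw [Matrix.mul_apply, sum3 F c]

/-! ### Bilinearity -/

lemma wedgeT_skew (x y : T3 F) : wedgeT F x y = - wedgeT F y x := by
  funext c d e
  simp only [Pi.neg_apply, wedgeT_apply]
  ring

lemma wedgeT_add (x y z : T3 F) : wedgeT F x (y + z) = wedgeT F x y + wedgeT F x z := by
  funext c d e
  simp only [Pi.add_apply, wedgeT_apply]
  ring

lemma wedgeT_sub (x y z : T3 F) : wedgeT F x (y - z) = wedgeT F x y - wedgeT F x z := by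
  funext c d e
  simp only [Pi.sub_apply, wedgeT_apply]
  ring

lemma actT_add (g : gl3 F × gl3 F × gl3 F) (y z : T3 F) :
    actT F g (y + z) = actT F g y + actT F g z := by
  funext c d e
  simp only [Pi.add_apply, actT_apply]
  ring

lemma actT_sub (g : gl3 F × gl3 F × gl3 F) (y z : T3 F) :
    actT F g (y - z) = actT F g y - actT F g z := by
  funext c d e
  simp only [Pi.sub_apply, actT_apply]
  ring

lemma coactT_add (g : gl3 F × gl3 F × gl3 F) (y z : T3 F) :
    coactT F g (y + z) = coactT F g y + coactT F g z := by
  funext c d e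
  simp only [Pi.add_apply, coactT_apply]
  ring

lemma coactT_sub (g : gl3 F × gl3 F × gl3 F) (y z : T3 F) :
    coactT F g (y - z) = coactT F g y - coactT F g z := by
  funext c d e
  simp only [Pi.sub_apply, coactT_apply]
  ring

/-- The commutator in `gl₃³`. -/
def comm3 (g h : gl3 F × gl3 F × gl3 F) : gl3 F × gl3 F × gl3 F :=
  (g.1 * h.1 - h.1 * g.1, g.2.1 * h.2.1 - h.2.1 * g.2.1, g.2.2 * h.2.2 - h.2.2 * g.2.2)

/-- The `L₀`-component of `[⊗f_i, ⊗x_i]`. -/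
def pairs (f x : T3 F) : gl3 F × gl3 F × gl3 F := (pair1 F f x, pair2 F f x, pair3 F f x)

lemma actT_addl (g h : gl3 F × gl3 F × gl3 F) (y : T3 F) :
    actT F (g + h) y = actT F g y + actT F h y := by
  funext c d e
  simp only [Pi.add_apply, actT_apply, Prod.fst_add, Prod.snd_add, Matrix.add_apply]
  ring

lemma actT_subl (g h : gl3 F × gl3 F × gl3 F) (y : T3 F) :
    actT F (g - h) y = actT F g y - actT F h y := by
  funext c d e
  simp only [Pi.sub_apply, actT_apply, Prod.fst_sub, Prod.snd_sub, Matrix.sub_apply]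
  ring

lemma coactT_addl (g h : gl3 F × gl3 F × gl3 F) (y : T3 F) :
    coactT F (g + h) y = coactT F g y + coactT F h y := by
  funext c d e
  simp only [Pi.add_apply, coactT_apply, Prod.fst_add, Prod.snd_add, Matrix.add_apply]
  ring

lemma coactT_subl (g h : gl3 F × gl3 F × gl3 F) (y : T3 F) :
    coactT F (g - h) y = coactT F g y - coactT F h y := by
  funext c d e
  simp only [Pi.sub_apply, coactT_apply, Prod.fst_sub, Prod.snd_sub, Matrix.sub_apply]
  ring

lemma tpair_add (f x y : T3 F) : tpair F f (x + y) = tpair F f x + tpair F f y := by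
  simp only [tpair_exp F 0 0 0, Pi.add_apply]
  ring

lemma tpair_addl (f g x : T3 F) : tpair F (f + g) x = tpair F f x + tpair F g x := by
  simp only [tpair_exp F 0 0 0, Pi.add_apply]
  ring

lemma pairs_add (f x y : T3 F) : pairs F f (x + y) = pairs F f x + pairs F f y := by
  refine Prod.ext ?_ (Prod.ext ?_ ?_) <;> ext r s <;>
  simp only [pairs, Prod.fst_add, Prod.snd_add, Matrix.add_apply, pair1_apply F 0 0,
    pair2_apply F 0 0, pair3_apply F 0 0, tpair_add, Pi.add_apply] <;>
  split_ifs <;> ring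

lemma pairs_addl (f g x : T3 F) : pairs F (f + g) x = pairs F f x + pairs F g x := by
  refine Prod.ext ?_ (Prod.ext ?_ ?_) <;> ext r s <;>
  simp only [pairs, Prod.fst_add, Prod.snd_add, Matrix.add_apply, pair1_apply F 0 0,
    pair2_apply F 0 0, pair3_apply F 0 0, tpair_addl, Pi.add_apply] <;>
  split_ifs <;> ring

lemma comm3_add (f x y : gl3 F × gl3 F × gl3 F) :
    comm3 F f (x + y) = comm3 F f x + comm3 F f y := by
  refine Prod.ext ?_ (Prod.ext ?_ ?_) <;>
  simp only [comm3, Prod.fst_add, Prod.snd_add] <;> noncomm_ring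

lemma tpair_sub (f x y : T3 F) : tpair F f (x - y) = tpair F f x - tpair F f y := by
  simp only [tpair_exp F 0 0 0, Pi.sub_apply]
  ring

lemma tpair_subl (f g x : T3 F) : tpair F (f - g) x = tpair F f x - tpair F g x := by
  simp only [tpair_exp F 0 0 0, Pi.sub_apply]
  ring

lemma pairs_sub (f x y : T3 F) : pairs F f (x - y) = pairs F f x - pairs F f y := by
  refine Prod.ext ?_ (Prod.ext ?_ ?_) <;> ext r s <;>
  simp only [pairs, Prod.fst_sub, Prod.snd_sub, Matrix.sub_apply, pair1_apply F 0 0,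
    pair2_apply F 0 0, pair3_apply F 0 0, tpair_sub, Pi.sub_apply] <;>
  split_ifs <;> ring

lemma pairs_subl (f g x : T3 F) : pairs F (f - g) x = pairs F f x - pairs F g x := by
  refine Prod.ext ?_ (Prod.ext ?_ ?_) <;> ext r s <;>
  simp only [pairs, Prod.fst_sub, Prod.snd_sub, Matrix.sub_apply, pair1_apply F 0 0,
    pair2_apply F 0 0, pair3_apply F 0 0, tpair_subl, Pi.sub_apply] <;>
  split_ifs <;> ring

lemma comm3_sub (f x y : gl3 F × gl3 F × gl3 F) :
    comm3 F f (x - y) = comm3 F f x - comm3 F f y := by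
  refine Prod.ext ?_ (Prod.ext ?_ ?_) <;>
  simp only [comm3, Prod.fst_sub, Prod.snd_sub] <;> noncomm_ring

lemma comm3_jacobi (f g h : gl3 F × gl3 F × gl3 F) :
    comm3 F f (comm3 F g h) + comm3 F g (comm3 F h f) + comm3 F h (comm3 F f g) = 0 := by
  refine Prod.ext ?_ (Prod.ext ?_ ?_) <;>
  simp only [comm3, Prod.fst_add, Prod.snd_add, Prod.fst_zero, Prod.snd_zero] <;> noncomm_ring

/-! ### Equivariance under `L₀` -/

lemma actT_comm3 (g h : gl3 F × gl3 F × gl3 F) (x : T3 F) :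
    actT F (comm3 F g h) x = actT F g (actT F h x) - actT F h (actT F g x) := by
  funext c d e
  simp only [Pi.sub_apply, actT_apply, comm3, Matrix.sub_apply, mul3 F c g.1, mul3 F c h.1,
    mul3 F d g.2.1, mul3 F d h.2.1, mul3 F e g.2.2, mul3 F e h.2.2,
    fin3_11, fin3_12, fin3_21, fin3_22]
  ring

lemma coactT_comm3 (g h : gl3 F × gl3 F × gl3 F) (x : T3 F) :
    coactT F (comm3 F g h) x = coactT F g (coactT F h x) - coactT F h (coactT F g x) := by
  funext c d e
  simp only [Pi.sub_apply, coactT_apply, comm3, Matrix.sub_apply, mul3 F c g.1, mul3 F c h.1,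
    mul3 F d g.2.1, mul3 F d h.2.1, mul3 F e g.2.2, mul3 F e h.2.2,
    fin3_11, fin3_12, fin3_21, fin3_22]
  ring

lemma coactT_wedgeT (g : gl3 F × gl3 F × gl3 F) (h1 : Matrix.trace g.1 = 0)
    (h2 : Matrix.trace g.2.1 = 0) (h3 : Matrix.trace g.2.2 = 0) (x y : T3 F) :
    coactT F g (wedgeT F x y) = wedgeT F x (actT F g y) - wedgeT F y (actT F g x) := by
  funext c d e
  have t1 := trace3 F c _ h1
  have t2 := trace3 F d _ h2
  have t3 := trace3 F e _ h3
  have hw := wedgeT_apply F x y c d e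
  simp only [Pi.sub_apply, coactT_apply, actT_apply, wedgeT_apply,
    fin3_11, fin3_12, fin3_21, fin3_22] at hw ⊢
  linear_combination (-wedgeT F x y c d e) * (t1 + t2 + t3)
    + (g.1 c c + g.1 (c+1) (c+1) + g.1 (c+2) (c+2)
      + g.2.1 d d + g.2.1 (d+1) (d+1) + g.2.1 (d+2) (d+2)
      + g.2.2 e e + g.2.2 (e+1) (e+1) + g.2.2 (e+2) (e+2)) * (wedgeT_apply F x y c d e)

lemma actT_wedgeT (g : gl3 F × gl3 F × gl3 F) (h1 : Matrix.trace g.1 = 0)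
    (h2 : Matrix.trace g.2.1 = 0) (h3 : Matrix.trace g.2.2 = 0) (x y : T3 F) :
    actT F g (wedgeT F x y) = wedgeT F x (coactT F g y) - wedgeT F y (coactT F g x) := by
  funext c d e
  have t1 := trace3 F c _ h1
  have t2 := trace3 F d _ h2
  have t3 := trace3 F e _ h3
  simp only [Pi.sub_apply, coactT_apply, actT_apply, wedgeT_apply,
    fin3_11, fin3_12, fin3_21, fin3_22]
  linear_combination (wedgeT F x y c d e) * (t1 + t2 + t3)
    - (g.1 c c + g.1 (c+1) (c+1) + g.1 (c+2) (c+2)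
      + g.2.1 d d + g.2.1 (d+1) (d+1) + g.2.1 (d+2) (d+2)
      + g.2.2 e e + g.2.2 (e+1) (e+1) + g.2.2 (e+2) (e+2)) * (wedgeT_apply F x y c d e)

lemma tpair_coact (g : gl3 F × gl3 F × gl3 F) (f x : T3 F) :
    tpair F (coactT F g f) x = - tpair F f (actT F g x) := by
  simp only [tpair_exp F 0 0 0, coactT_apply, actT_apply, fin3_11, fin3_12, fin3_21, fin3_22]
  ring

lemma pairs_coact (g : gl3 F × gl3 F × gl3 F) (f x : T3 F) :
    pairs F (coactT F g f) x = comm3 F g (pairs F f x) - pairs F f (actT F g x) := by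
  refine Prod.ext ?_ (Prod.ext ?_ ?_) <;> ext r s <;> rcases fin3_cases r s with rfl | rfl | rfl <;>
  simp only [pairs, comm3, Prod.fst_sub, Prod.snd_sub, Matrix.sub_apply, mul3 F r,
    pair1_apply F 0 0, pair2_apply F 0 0, pair3_apply F 0 0, tpair_coact,
    fin3_ne1, fin3_ne2, fin3_ne3, fin3_ne4, fin3_ne5, fin3_ne6, if_true, if_false,
    coactT_apply, actT_apply, fin3_11, fin3_12, fin3_21, fin3_22] <;>
  ring

/-! ### The identities involving three elements of `L₁ ⊕ L₂` -/

lemma cyc_x (x y z : T3 F) :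
    pairs F (wedgeT F x y) z + pairs F (wedgeT F y z) x + pairs F (wedgeT F z x) y = 0 := by
  refine Prod.ext ?_ (Prod.ext ?_ ?_) <;> ext r s <;> rcases fin3_cases r s with rfl | rfl | rfl <;>
  simp only [pairs, Prod.fst_add, Prod.snd_add, Prod.fst_zero, Prod.snd_zero, Matrix.add_apply,
    Matrix.zero_apply, pair1_apply F r r, pair2_apply F r r, pair3_apply F r r, tpair_exp F r r r,
    fin3_ne1, fin3_ne2, fin3_ne3, fin3_ne4, fin3_ne5, fin3_ne6, if_true, if_false,
    wedgeT_apply, fin3_11, fin3_12, fin3_21, fin3_22] <;>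
  ring

lemma tpair_comm (f x : T3 F) : tpair F f x = tpair F x f := by
  simp only [tpair, mul_comm]

lemma pair1_swap (f x : T3 F) : pair1 F f x = (pair1 F x f)ᵀ := by
  ext r s
  simp only [pair1, Matrix.transpose_apply, Matrix.of_apply, tpair_comm F f x, mul_comm, eq_comm]

lemma pair2_swap (f x : T3 F) : pair2 F f x = (pair2 F x f)ᵀ := by
  ext r s
  simp only [pair2, Matrix.transpose_apply, Matrix.of_apply, tpair_comm F f x, mul_comm, eq_comm]

lemma pair3_swap (f x : T3 F) : pair3 F f x = (pair3 F x f)ᵀ := by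
  ext r s
  simp only [pair3, Matrix.transpose_apply, Matrix.of_apply, tpair_comm F f x, mul_comm, eq_comm]

lemma cyc_f (x y z : T3 F) :
    pairs F z (wedgeT F x y) + pairs F x (wedgeT F y z) + pairs F y (wedgeT F z x) = 0 := by
  have h := cyc_x F x y z
  simp only [pairs, Prod.mk_add_mk, Prod.mk_eq_zero] at h ⊢
  obtain ⟨h1, h2, h3⟩ := h
  refine ⟨?_, ?_, ?_⟩
  · simpa [← pair1_swap] using congrArg Matrix.transpose h1
  · simpa [← pair2_swap] using congrArg Matrix.transpose h2
  · simpa [← pair3_swap] using congrArg Matrix.transpose h3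

lemma act_pairs (f x y : T3 F) :
    actT F (pairs F f y) x - actT F (pairs F f x) y + wedgeT F f (wedgeT F x y) = 0 := by
  funext c d e
  simp only [Pi.add_apply, Pi.sub_apply, Pi.zero_apply, actT_apply, pairs, pair1_apply F d e,
    pair2_apply F c e, pair3_apply F c d, tpair_exp F c d e,
    fin3_ne1, fin3_ne2, fin3_ne3, fin3_ne4, fin3_ne5, fin3_ne6, if_true, if_false,
    wedgeT_apply, fin3_11, fin3_12, fin3_21, fin3_22]
  ring

lemma coact_pairs (x f h : T3 F) :
    coactT F (pairs F f x) h - coactT F (pairs F h x) f + wedgeT F x (wedgeT F f h) = 0 := by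
  funext c d e
  simp only [Pi.add_apply, Pi.sub_apply, Pi.zero_apply, coactT_apply, pairs, pair1_apply F d e,
    pair2_apply F c e, pair3_apply F c d, tpair_exp F c d e,
    fin3_ne1, fin3_ne2, fin3_ne3, fin3_ne4, fin3_ne5, fin3_ne6, if_true, if_false,
    wedgeT_apply, fin3_11, fin3_12, fin3_21, fin3_22]
  ring

/-! ### Assembly -/

lemma B_eq (u v : Mbig F) : B F u v =
    ( comm3 F u.1 v.1 + pairs F u.2.2 v.2.1 - pairs F v.2.2 u.2.1,
      ( actT F u.1 v.2.1 - actT F v.1 u.2.1 + wedgeT F u.2.2 v.2.2,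
        coactT F u.1 v.2.2 - coactT F v.1 u.2.2 + wedgeT F u.2.1 v.2.1 ) ) := rfl

lemma B_skew (u v : Mbig F) : B F u v = - B F v u := by
  simp only [B_eq, Prod.neg_mk]
  refine Prod.ext ?_ (Prod.ext ?_ ?_)
  · have : comm3 F u.1 v.1 = - comm3 F v.1 u.1 := by simp [comm3]
    simp only [this]; abel
  · simp only [wedgeT_skew F u.2.2]; abel
  · simp only [wedgeT_skew F u.2.1]; abel

lemma B_jacobi (u v w : Mbig F) (hu : u ∈ Lsub F) (hv : v ∈ Lsub F) (hw : w ∈ Lsub F) :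
    B F u (B F v w) + B F v (B F w u) + B F w (B F u v) = 0 := by
  obtain ⟨a, x, f⟩ := u
  obtain ⟨b, y, g⟩ := v
  obtain ⟨c, z, h⟩ := w
  obtain ⟨⟨a1, a2, a3⟩, -⟩ := hu
  obtain ⟨⟨b1, b2, b3⟩, -⟩ := hv
  obtain ⟨⟨c1, c2, c3⟩, -⟩ := hw
  have wa := coactT_wedgeT F a a1 a2 a3
  have wb := coactT_wedgeT F b b1 b2 b3
  have wc := coactT_wedgeT F c c1 c2 c3
  have va := actT_wedgeT F a a1 a2 a3
  have vb := actT_wedgeT F b b1 b2 b3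
  have vc := actT_wedgeT F c c1 c2 c3
  refine Prod.ext ?_ (Prod.ext ?_ ?_)
  · have k1 := comm3_jacobi F a b c
    have k2 := cyc_x F x y z
    have k3 := cyc_f F f g h
    simp only [B_eq, Prod.mk_add_mk, Prod.fst_zero, comm3_add, comm3_sub, pairs_add, pairs_sub,
      pairs_addl, pairs_subl, pairs_coact]
    linear_combination (norm := module) k1 - k2 + k3
  · have k1 := act_pairs F f y z
    have k2 := act_pairs F g z x
    have k3 := act_pairs F h x y
    simp only [B_eq, Prod.mk_add_mk, Prod.fst_zero, Prod.snd_zero, actT_add, actT_sub, actT_addl,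
      actT_subl, actT_comm3, wedgeT_add, wedgeT_sub, va, vb, vc]
    linear_combination (norm := module) k1 + k2 + k3
  · have k1 := coact_pairs F x g h
    have k2 := coact_pairs F y h f
    have k3 := coact_pairs F z f g
    simp only [B_eq, Prod.mk_add_mk, Prod.snd_zero, coactT_add, coactT_sub, coactT_addl,
      coactT_subl, coactT_comm3, wedgeT_add, wedgeT_sub, wa, wb, wc]
    linear_combination (norm := module) k1 + k2 + k3

lemma finrank_sl3 : Module.finrank F (sl3 F) = 8 := by
  have hk : sl3 F = LinearMap.ker (Matrix.traceLinearMap (Fin 3) F F) := by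
    ext g; simp [mem_sl3]
  have hs : LinearMap.range (Matrix.traceLinearMap (Fin 3) F F) = ⊤ := by
    rw [LinearMap.range_eq_top]
    intro c
    exact ⟨Matrix.single 0 0 c, by simp⟩
  have h := LinearMap.finrank_range_add_finrank_ker (Matrix.traceLinearMap (Fin 3) F F)
  rw [hs, finrank_top, ← hk] at h
  rw [Module.finrank_self, Module.finrank_matrix, Module.finrank_self, Fintype.card_fin] at h
  have h2 : 1 + Module.finrank F (sl3 F) = 3 * 3 * 1 := h
  omega

lemma finrank_prod_sub {M N : Type*} [AddCommGroup M] [Module F M] [AddCommGroup N] [Module F N]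
    [Module.Finite F M] [Module.Finite F N] (p : Submodule F M) (q : Submodule F N) :
    Module.finrank F (p.prod q) = Module.finrank F p + Module.finrank F q := by
  let e : ↥(p.prod q) ≃ₗ[F] ↥p × ↥q :=
    { toFun := fun x => (⟨x.1.1, x.2.1⟩, ⟨x.1.2, x.2.2⟩)
      invFun := fun x => ⟨(x.1.1, x.2.1), x.1.2, x.2.2⟩
      left_inv := fun _ => rfl
      right_inv := fun _ => rfl
      map_add' := fun _ _ => rfl
      map_smul' := fun _ _ => rfl }
  rw [e.finrank_eq, Module.finrank_prod]

lemma finrank_T3 : Module.finrank F (T3 F) = 27 := by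
  simp [T3, Module.finrank_pi_fintype]

lemma finrank_Lsub : Module.finrank F ↥(Lsub F) = 78 := by
  unfold Lsub
  rw [finrank_prod_sub, finrank_prod_sub, finrank_prod_sub, finrank_prod_sub, finrank_sl3,
    finrank_top, finrank_T3]

/-- the bracket on `L = sl(X₁)⊕sl(X₂)⊕sl(X₃) ⊕ X₁⊗X₂⊗X₃ ⊕ X₁*⊗X₂*⊗X₃*` is
skew-symmetric and satisfies the Jacobi identity, so `L` is a Lie algebra over `F`;
its dimension is 78 (`L` is a model of `e₆`). -/
theorem e6_model_is_lie_algebra_of_dim_78 :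
    (∀ u v : Mbig F, u ∈ Lsub F → v ∈ Lsub F → B F u v ∈ Lsub F) ∧
    (∀ u v : ↥(Lsub F), Bsub F u v = - Bsub F v u) ∧
    (∀ u v w : ↥(Lsub F),
      Bsub F u (Bsub F v w) + Bsub F v (Bsub F w u) + Bsub F w (Bsub F u v) = 0) ∧
    Module.finrank F ↥(Lsub F) = 78 := by
  refine ⟨fun u v _ _ => B_mem F u v, fun u v => Subtype.ext (B_skew F u v),
    fun u v w => Subtype.ext (B_jacobi F u v w u.2 v.2 w.2), finrank_Lsub F⟩

end
end
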